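/- arXiv:2011.14363 — 4 statements merged into one kernel-verified Lean document; each statement's English description precedes it below -/
import Mathlib

section
/- Let n, k, m be positive integers with n > 3k²m. If F = {F_1, ..., F_m} is a family of k-graphs on the common vertex set [n] such that |F_i| > f(n,m,k) for every i ∈ [m], then F admits a rainbow matching. -/
open Finset

/-- `f(n,m,k) = max{C(n,k) - C(n-m+1,k), C(km-1,k)}`. -/
def fEMC (n m k : ℕ) : ℕ :=
  max (Nat.choose n k - Nat.choose (n - m + 1) k) (Nat.choose (k * m - 1) k)

/-- `F` is a `k`-graph on the vertex set `[n] = {1,…,n}`. -/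
def IsKGraphOn (n k : ℕ) (F : Finset (Finset ℕ)) : Prop :=
  ∀ e ∈ F, e ⊆ Finset.Icc 1 n ∧ e.card = k

/-- The family `F = (F_1,…,F_m)` admits a rainbow matching. -/
def HasRainbowMatching {m : ℕ} (F : Fin m → Finset (Finset ℕ)) : Prop :=
  ∃ e : Fin m → Finset ℕ, (∀ i, e i ∈ F i) ∧
    ∀ i j : Fin m, i ≠ j → Disjoint (e i) (e j)

/-- Degree of a vertex `v` in the hypergraph `F`. -/
def degOf (F : Finset (Finset ℕ)) (v : ℕ) : ℕ := (F.filter (fun e => v ∈ e)).card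

/-- The family `F` of `k`-graphs on `[n]` is saturated. -/
def Saturated (n k : ℕ) {m : ℕ} (F : Fin m → Finset (Finset ℕ)) : Prop :=
  ¬ HasRainbowMatching F ∧
    ∀ (i : Fin m) (e : Finset ℕ), e ⊆ Finset.Icc 1 n → e.card = k → e ∉ F i →
      HasRainbowMatching (Function.update F i (insert e (F i)))

/-- Elementwise domination order: the increasing enumeration of `e` is
pointwise at most that of `f` (this forces `e.card = f.card`). -/
def DomLE (e f : Finset ℕ) : Prop :=
  List.Forall₂ (· ≤ ·) (e.sort (· ≤ ·)) (f.sort (· ≤ ·))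

/-- `F` is a stable hypergraph on vertex set `[n]`. -/
def StableGraph (n : ℕ) (F : Finset (Finset ℕ)) : Prop :=
  ∀ e f : Finset ℕ, e ⊆ Finset.Icc 1 n → DomLE e f → f ∈ F → e ∈ F

/-- `S(n,m,k)`: all `k`-subsets of `[n]` meeting `[m-1]`. -/
def SGraph (n m k : ℕ) : Finset (Finset ℕ) :=
  ((Finset.Icc 1 n).powersetCard k).filter (fun e => (e ∩ Finset.Icc 1 (m - 1)).Nonempty)

/-- `D(n,m,k)`: all `k`-subsets of `[km-1]`. -/
def DGraph (n m k : ℕ) : Finset (Finset ℕ) :=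
  (Finset.Icc 1 (k * m - 1)).powersetCard k

/-- `H(F)`: the `(k+1)`-graph on `[n] ∪ {v_1,…,v_m}`, where `v_i` is encoded
as the natural number `n + i`, with edges `e ∪ {v_i}` for `e ∈ F_i`. -/
def HF (n : ℕ) {m : ℕ} (F : Fin m → Finset (Finset ℕ)) : Finset (Finset ℕ) :=
  Finset.univ.biUnion (fun i : Fin m => (F i).image (fun e => insert (n + i.1 + 1) e))

/-- `H_S(n,m,k) = H(F)` with every `F_i = S(n,m,k)`. -/
def HS (n m k : ℕ) : Finset (Finset ℕ) := HF n (fun _ : Fin m => SGraph n m k)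

/-- `H_D(n,m,k) = H(F)` with every `F_i = D(n,m,k)`. -/
def HD (n m k : ℕ) : Finset (Finset ℕ) := HF n (fun _ : Fin m => DGraph n m k)

/-- `H*(F)`: `H(F)` together with the edges `e ∪ {u_j}`, `e` a `k`-subset of `[n]`,
`j ∈ [r]`, `r = ⌊n/k⌋ - m`, where `u_j` is encoded as the natural number `n + m + j`. -/
def HstarF (n k : ℕ) {m : ℕ} (F : Fin m → Finset (Finset ℕ)) : Finset (Finset ℕ) :=
  HF n F ∪ Finset.univ.biUnion (fun j : Fin (n / k - m) =>
    ((Finset.Icc 1 n).powersetCard k).image (fun e => insert (n + m + j.1 + 1) e))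

/-- A set of edges is a matching if its edges are pairwise disjoint. -/
def IsMatching (M : Finset (Finset ℕ)) : Prop :=
  ∀ e ∈ M, ∀ f ∈ M, e ≠ f → Disjoint e f

/-- `H₂` is `ε`-close to `H₁` (as `u`-graphs on a vertex set of size `N`):
`|E(H₁) \ E(H₂)| ≤ ε · N^u`. -/
def IsEpsClose (ε : ℝ) (N u : ℕ) (H₁ H₂ : Finset (Finset ℕ)) : Prop :=
  (((H₁ \ H₂).card : ℝ)) ≤ ε * (N : ℝ) ^ u

/-- rainbow matching indexed by a finset -/
def RMx (I : Finset ℕ) (F : ℕ → Finset (Finset ℕ)) : Prop :=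
  ∃ e : ℕ → Finset ℕ, (∀ i ∈ I, e i ∈ F i) ∧ ∀ i ∈ I, ∀ j ∈ I, i ≠ j → Disjoint (e i) (e j)

lemma choose_upper (a r N : ℕ) : ∀ b, a + b ≤ N + 1 →
    Nat.choose (a + b) (r + 1) ≤ Nat.choose a (r + 1) + b * Nat.choose N r := by
  intro b
  induction b with
  | zero => intro _; simp
  | succ b ih =>
    intro h
    have h1 := ih (by omega)
    have h2 : Nat.choose (a + b) r ≤ Nat.choose N r := Nat.choose_le_choose r (by omega)
    rw [← add_assoc, Nat.choose_succ_succ']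
    nlinarith

lemma choose_lower (a r : ℕ) : ∀ b,
    Nat.choose a (r + 1) + b * Nat.choose a r ≤ Nat.choose (a + b) (r + 1) := by
  intro b
  induction b with
  | zero => simp
  | succ b ih =>
    have h2 : Nat.choose a r ≤ Nat.choose (a + b) r := Nat.choose_le_choose r (by omega)
    rw [← add_assoc, Nat.choose_succ_succ']
    nlinarith

lemma sup_count (V S : Finset ℕ) (k : ℕ) (F : Finset (Finset ℕ)) (hS : S ⊆ V)
    (hF : ∀ e ∈ F, e ⊆ V ∧ e.card = k) :
    (F.filter (fun e => S ⊆ e)).card ≤ Nat.choose (V.card - S.card) (k - S.card) := by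
  rw [← card_sdiff_of_subset hS, ← card_powersetCard]
  apply card_le_card_of_injOn (fun e => e \ S)
  · intro e he
    rw [mem_coe, mem_filter] at he
    rw [mem_coe, mem_powersetCard]
    refine ⟨sdiff_subset_sdiff (hF e he.1).1 (le_refl _), ?_⟩
    rw [card_sdiff_of_subset he.2, (hF e he.1).2]
  · intro e he f hf h
    rw [mem_coe, mem_filter] at he hf
    simp only at h
    rw [← sdiff_union_of_subset he.2, ← sdiff_union_of_subset hf.2, h]

lemma deg_le (V : Finset ℕ) (k v : ℕ) (F : Finset (Finset ℕ)) (hv : v ∈ V)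
    (hF : ∀ e ∈ F, e ⊆ V ∧ e.card = k + 1) :
    (F.filter (fun e => v ∈ e)).card ≤ Nat.choose (V.card - 1) k := by
  have := sup_count V {v} (k + 1) F (by simpa using hv) hF
  simpa using this

lemma pair_le (V : Finset ℕ) (k u v : ℕ) (F : Finset (Finset ℕ)) (hv : v ∈ V) (hu : u ∈ V)
    (huv : u ≠ v) (hF : ∀ e ∈ F, e ⊆ V ∧ e.card = k + 2) :
    ((F.filter (fun e => v ∈ e)).filter (fun e => u ∈ e)).card ≤ Nat.choose (V.card - 2) k := by
  have := sup_count V {u, v} (k + 2) F (by intro x; simp; rintro (rfl | rfl) <;> assumption) hF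
  rw [card_pair huv, Nat.add_sub_cancel] at this
  rw [filter_filter]
  convert this using 3
  simp [insert_subset_iff, and_comm]

lemma meet_count (F : Finset (Finset ℕ)) (U : Finset ℕ) :
    (F.filter (fun e => ¬ Disjoint e U)).card ≤ ∑ u ∈ U, (F.filter (fun e => u ∈ e)).card := by
  refine le_trans (card_le_card ?_) card_biUnion_le
  intro e he
  rw [mem_filter, not_disjoint_iff] at he
  obtain ⟨h, x, hx, hxU⟩ := he
  simp only [mem_biUnion, mem_filter]
  exact ⟨x, hxU, h, hx⟩

lemma exists_disj (F : Finset (Finset ℕ)) (U : Finset ℕ)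
    (h : ∑ u ∈ U, (F.filter (fun e => u ∈ e)).card < F.card) : ∃ e ∈ F, Disjoint e U := by
  by_contra! hc
  have := meet_count F U
  rw [filter_true_of_mem hc] at this
  omega

lemma RMx_extend (I : Finset ℕ) (F : ℕ → Finset (Finset ℕ)) (i : ℕ)
    (e : ℕ → Finset ℕ) (h1 : ∀ j ∈ I.erase i, e j ∈ F j)
    (h2 : ∀ a ∈ I.erase i, ∀ b ∈ I.erase i, a ≠ b → Disjoint (e a) (e b))
    (f : Finset ℕ) (hf : f ∈ F i) (hd : Disjoint f ((I.erase i).biUnion e)) : RMx I F := by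
  rw [disjoint_biUnion_right] at hd
  refine ⟨fun j => if j = i then f else e j, ?_, ?_⟩
  · intro j hj
    by_cases h : j = i
    · subst h; simpa using hf
    · simpa [h] using h1 j (mem_erase.2 ⟨h, hj⟩)
  · intro a ha b hb hab
    by_cases h : a = i
    · subst h
      have : b ≠ a := fun h => hab h.symm
      simpa [this] using hd b (mem_erase.2 ⟨this, hb⟩)
    · by_cases h' : b = i
      · subst h'
        simpa [h] using (hd a (mem_erase.2 ⟨h, ha⟩)).symm
      · simpa [h, h'] using h2 a (mem_erase.2 ⟨h, ha⟩) b (mem_erase.2 ⟨h', hb⟩) hab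

lemma U_card (V I : Finset ℕ) (k : ℕ) (F : ℕ → Finset (Finset ℕ)) (e : ℕ → Finset ℕ)
    (h1 : ∀ j ∈ I, e j ∈ F j) (hF : ∀ i ∈ I, ∀ e ∈ F i, e ⊆ V ∧ e.card = k) :
    (I.biUnion e).card ≤ I.card * k ∧ I.biUnion e ⊆ V := by
  constructor
  · exact card_biUnion_le_card_mul _ _ _ (fun j hj => (hF j hj _ (h1 j hj)).2.le)
  · exact biUnion_subset.2 (fun j hj => (hF j hj _ (h1 j hj)).1)

lemma exists_sdr (I : Finset ℕ) (H : ℕ → Finset ℕ) (h : ∀ i ∈ I, I.card ≤ (H i).card) :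
    ∃ v : ℕ → ℕ, (∀ i ∈ I, v i ∈ H i) ∧ Set.InjOn v I := by
  suffices hs : ∀ J ⊆ I, ∃ v : ℕ → ℕ, (∀ i ∈ J, v i ∈ H i) ∧ Set.InjOn v J from hs I (le_refl _)
  intro J
  induction J using Finset.induction_on with
  | empty => intro _; exact ⟨id, by simp, by simp⟩
  | insert a J ha ih =>
    intro hJ
    obtain ⟨v, hv, hinj⟩ := ih (fun x hx => hJ (mem_insert_of_mem hx))
    have haI := hJ (mem_insert_self a J)
    have hc : (J.image v).card < (H a).card := by
      have h1 := card_le_card hJ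
      rw [card_insert_of_notMem ha] at h1
      have h2 : (J.image v).card ≤ J.card := card_image_le
      have := h a haI
      omega
    obtain ⟨x, hx, hxn⟩ := exists_mem_notMem_of_card_lt_card hc
    have hne : ∀ j ∈ J, j ≠ a := fun j hj h => ha (h ▸ hj)
    refine ⟨Function.update v a x, ?_, ?_⟩
    · intro i hi
      rcases mem_insert.1 hi with rfl | hi
      · simpa using hx
      · rw [Function.update_of_ne (hne i hi)]; exact hv i hi
    · intro p hp q hq hpq
      have hp1 := mem_insert.1 (mem_coe.1 hp)
      have hq1 := mem_insert.1 (mem_coe.1 hq)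
      clear hp hq
      rcases hp1 with rfl | hp <;> rcases hq1 with rfl | hq
      · rfl
      · rw [Function.update_self, Function.update_of_ne (hne q hq)] at hpq
        exact absurd (mem_image.2 ⟨q, hq, hpq.symm⟩) hxn
      · rw [Function.update_self, Function.update_of_ne (hne p hp)] at hpq
        exact absurd (mem_image.2 ⟨p, hp, hpq⟩) hxn
      · rw [Function.update_of_ne (hne q hq), Function.update_of_ne (hne p hp)] at hpq
        exact hinj hp hq hpq

/-- The statement for `k` and `m`. -/
def Stm (k m : ℕ) : Prop := ∀ (I V : Finset ℕ) (F : ℕ → Finset (Finset ℕ)), I.card = m →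
  3 * k ^ 2 * m < V.card → (∀ i ∈ I, ∀ e ∈ F i, e ⊆ V ∧ e.card = k) →
  (∀ i ∈ I, Nat.choose V.card k < (F i).card + Nat.choose (V.card - m + 1) k) → RMx I F

lemma stm_zero (k : ℕ) : Stm k 0 := by
  intro I V F hI _ _ _
  rw [card_eq_zero] at hI
  subst hI
  exact ⟨fun _ => ∅, by simp, by simp⟩

lemma stm_one (m : ℕ) : Stm 1 m := by
  induction m with
  | zero => exact stm_zero 1
  | succ m ih =>
    intro I V F hI hV hF hc
    obtain ⟨i, hi⟩ : I.Nonempty := by rw [← card_pos]; omega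
    have hcard : (I.erase i).card = m := by rw [card_erase_of_mem hi]; omega
    obtain ⟨e, h1, h2⟩ := ih (I.erase i) V F hcard (by omega)
      (fun j hj => hF j (mem_of_mem_erase hj)) (fun j hj => by
        have := hc j (mem_of_mem_erase hj)
        simp only [Nat.choose_one_right] at this ⊢
        omega)
    obtain ⟨hU, hUV⟩ := U_card V (I.erase i) 1 F e h1 (fun j hj => hF j (mem_of_mem_erase hj))
    obtain ⟨f, hf, hd⟩ := exists_disj (F i) ((I.erase i).biUnion e) (by
      calc _ ≤ ∑ u ∈ (I.erase i).biUnion e, 1 := by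
            apply sum_le_sum
            intro u hu
            simpa using deg_le V 0 u (F i) (hUV hu) (hF i hi)
        _ < _ := by
            have := hc i hi
            simp only [Nat.choose_one_right] at this
            simp
            omega)
    exact RMx_extend I F i e h1 h2 f hf hd

lemma caseA (r m : ℕ) (ih : Stm (r + 2) m) (I V : Finset ℕ) (F : ℕ → Finset (Finset ℕ))
    (hI : I.card = m + 1) (hV : 3 * (r + 2) ^ 2 * (m + 1) < V.card)
    (hF : ∀ i ∈ I, ∀ e ∈ F i, e ⊆ V ∧ e.card = r + 2)
    (hc : ∀ i ∈ I, Nat.choose V.card (r + 2) <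
      (F i).card + Nat.choose (V.card - (m + 1) + 1) (r + 2))
    (i v : ℕ) (hi : i ∈ I) (hv : v ∈ V)
    (hd : (m * (r + 2)) * Nat.choose (V.card - 2) r < ((F i).filter (fun e => v ∈ e)).card) :
    RMx I F := by
  have hcard : (I.erase i).card = m := by rw [card_erase_of_mem hi]; omega
  have hVm : m + 1 < V.card := lt_of_le_of_lt (Nat.le_mul_of_pos_left _ (by positivity)) hV
  have hF' : ∀ j ∈ I.erase i, ∀ e ∈ (F j).filter (fun e => v ∉ e),
      e ⊆ V.erase v ∧ e.card = r + 2 := by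
    intro j hj e he
    rw [mem_filter] at he
    have := hF j (mem_of_mem_erase hj) e he.1
    exact ⟨subset_erase.2 ⟨this.1, he.2⟩, this.2⟩
  obtain ⟨e, h1, h2⟩ := ih (I.erase i) (V.erase v) (fun j => (F j).filter (fun e => v ∉ e)) hcard
    (by rw [card_erase_of_mem hv]
        have : 0 < (r+2)^2 := by positivity
        have : 3 * (r + 2) ^ 2 * (m + 1) = 3 * (r + 2) ^ 2 * m + 3 * (r + 2) ^ 2 := by ring
        omega) hF' (by
      intro j hj
      have hj' := mem_of_mem_erase hj
      have a1 := hc j hj'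
      have a2 := deg_le V (r + 1) v (F j) hv (hF j hj')
      have a3 := card_filter_add_card_filter_not (s := F j) (fun e => v ∈ e)
      rw [card_erase_of_mem hv]
      obtain ⟨n, hn⟩ : ∃ n, V.card = n + 1 := ⟨V.card - 1, by omega⟩
      rw [hn] at a1 a2 ⊢
      rw [Nat.choose_succ_succ', show r + 1 + 1 = r + 2 from rfl] at a1
      have : n + 1 - 1 - m + 1 = n + 1 - (m + 1) + 1 := by omega
      rw [this]
      simp only [Nat.add_sub_cancel] at a2 ⊢
      omega)
  obtain ⟨hU, hUV⟩ := U_card (V.erase v) (I.erase i) (r + 2) _ e h1 hF'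
  obtain ⟨f, hf, hdis⟩ := exists_disj ((F i).filter (fun e => v ∈ e)) ((I.erase i).biUnion e) (by
    refine lt_of_le_of_lt ?_ hd
    calc _ ≤ ∑ u ∈ (I.erase i).biUnion e, Nat.choose (V.card - 2) r := by
          apply sum_le_sum
          intro u hu
          have := mem_erase.1 (hUV hu)
          exact pair_le V r u v (F i) hv this.2 this.1 (hF i hi)
      _ ≤ _ := by
          rw [sum_const, smul_eq_mul]
          rw [hcard] at hU
          exact Nat.mul_le_mul_right _ hU)
  exact RMx_extend I F i e (fun j hj => (mem_filter.1 (h1 j hj)).1) h2 f (mem_filter.1 hf).1 hdis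

lemma numer (r m n : ℕ) (hn : 3 * (r + 2) ^ 2 * (m + 1) < n) :
    (3 * r + 4) * m ^ 2 * Nat.choose (n - 2) r + Nat.choose (n - (m + 1) + 1) (r + 2)
      ≤ Nat.choose n (r + 2) := by
  rcases Nat.eq_zero_or_pos m with rfl | hm
  · have : n - (0 + 1) + 1 = n := by
      have : 0 < 3 * (r + 2) ^ 2 * (0 + 1) := by positivity
      omega
    rw [this]; simp
  obtain ⟨p, rfl⟩ : ∃ p, m = p + 1 := ⟨m - 1, by omega⟩
  obtain ⟨a, rfl⟩ : ∃ a, n = a + (p + 1) := ⟨n - (p + 1), by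
    have : p + 1 + 1 ≤ 3 * (r + 2) ^ 2 * (p + 1 + 1) := Nat.le_mul_of_pos_left _ (by positivity)
    omega⟩
  have e1 : a + (p + 1) - (p + 1 + 1) + 1 = a := by
    have : p + 1 + 1 ≤ 3 * (r + 2) ^ 2 * (p + 1 + 1) := Nat.le_mul_of_pos_left _ (by positivity)
    omega
  rw [e1]
  have l1 := choose_lower a (r + 1) (p + 1)
  have e2 : a + (p + 1) - 2 = a + p - 1 := by omega
  have l2 := choose_upper a r (a + p - 1) p (by omega)
  have l3 : (r + 1) * Nat.choose (a + p) (r + 1) = (a + p) * Nat.choose (a + p - 1) r := by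
    obtain ⟨b, hb⟩ : ∃ b, a + p = b + 1 := ⟨a + p - 1, by nlinarith [Nat.sub_add_cancel (show 1 ≤ a + p by nlinarith)]⟩
    rw [hb]
    have := Nat.add_one_mul_choose_eq b r
    simp only [Nat.add_sub_cancel]
    linarith
  rw [e2]
  set C := Nat.choose (a + p - 1) r
  set X := Nat.choose (a + p) (r + 1)
  set Y := Nat.choose a (r + 1)
  have key : (3 * r + 4) * (p + 1) * C ≤ Y := by
    have k1 : (r + 1) * ((3 * r + 4) * (p + 1) + p) ≤ a + p := by nlinarith [Nat.zero_le (r * p), Nat.zero_le (r * r * p)]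
    have k2 : (r + 1) * (((3 * r + 4) * (p + 1) + p) * C) ≤ (r + 1) * X := by
      rw [l3, ← mul_assoc]
      exact Nat.mul_le_mul_right _ k1
    have k3 := Nat.le_of_mul_le_mul_left k2 (Nat.succ_pos r)
    have : ((3 * r + 4) * (p + 1) + p) * C = (3 * r + 4) * (p + 1) * C + p * C := by ring
    omega
  have : (p + 1) * ((3 * r + 4) * (p + 1) * C) ≤ (p + 1) * Y := Nat.mul_le_mul_left _ key
  have e3 : (p + 1) * ((3 * r + 4) * (p + 1) * C) = (3 * r + 4) * (p + 1) ^ 2 * C := by ring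
  have e4 : r + 1 + 1 = r + 2 := rfl
  rw [e4] at l1
  omega

lemma caseB2 (r m : ℕ) (ih : Stm (r + 2) m) (I V : Finset ℕ) (F : ℕ → Finset (Finset ℕ))
    (hI : I.card = m + 1) (hV : 3 * (r + 2) ^ 2 * (m + 1) < V.card)
    (hF : ∀ i ∈ I, ∀ e ∈ F i, e ⊆ V ∧ e.card = r + 2)
    (hc : ∀ i ∈ I, Nat.choose V.card (r + 2) <
      (F i).card + Nat.choose (V.card - (m + 1) + 1) (r + 2))
    (i : ℕ) (hi : i ∈ I)
    (hd : ∀ v ∈ V, ((F i).filter (fun e => v ∈ e)).card ≤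
      (m * (r + 2)) * Nat.choose (V.card - 2) r)
    (hH : (V.filter (fun v => 2 * m * Nat.choose (V.card - 2) r <
      ((F i).filter (fun e => v ∈ e)).card)).card ≤ m) :
    RMx I F := by
  have hcard : (I.erase i).card = m := by rw [card_erase_of_mem hi]; omega
  obtain ⟨e, h1, h2⟩ := ih (I.erase i) V F hcard (by nlinarith)
      (fun j hj => hF j (mem_of_mem_erase hj)) (fun j hj => by
        have := hc j (mem_of_mem_erase hj)
        have h' : Nat.choose (V.card - (m + 1) + 1) (r + 2) ≤ Nat.choose (V.card - m + 1) (r + 2) :=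
          Nat.choose_le_choose _ (by omega)
        omega)
  obtain ⟨hU, hUV⟩ := U_card V (I.erase i) (r + 2) F e h1 (fun j hj => hF j (mem_of_mem_erase hj))
  have hn := numer r m V.card hV
  have hci := hc i hi
  set U := (I.erase i).biUnion e
  set C := Nat.choose (V.card - 2) r
  obtain ⟨f, hf, hdis⟩ := exists_disj (F i) U (by
    calc _ ≤ ∑ u ∈ U, (2 * m * C + if 2 * m * C < ((F i).filter (fun e => u ∈ e)).card then m * r * C else 0) := by
          apply sum_le_sum
          intro u hu
          have := hd u (hUV hu)
          split_ifs with h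
          · calc _ ≤ _ := this
              _ = _ := by ring
          · omega
      _ ≤ m * (r + 2) * (2 * m * C) + m * (m * r * C) := by
          rw [sum_add_distrib, sum_const, smul_eq_mul, ← sum_filter, sum_const, smul_eq_mul]
          rw [hcard] at hU
          apply Nat.add_le_add (Nat.mul_le_mul_right _ hU)
          apply Nat.mul_le_mul_right
          exact le_trans (card_le_card (filter_subset_filter _ hUV)) hH
      _ = (3 * r + 4) * m ^ 2 * C := by ring
      _ < _ := by omega)
  exact RMx_extend I F i e h1 h2 f hf hdis

lemma caseB1 (r m : ℕ) (ih : Stm (r + 1) (m + 1)) (I V : Finset ℕ) (F : ℕ → Finset (Finset ℕ))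
    (hI : I.card = m + 1) (hV : 3 * (r + 2) ^ 2 * (m + 1) < V.card)
    (hF : ∀ i ∈ I, ∀ e ∈ F i, e ⊆ V ∧ e.card = r + 2)
    (hH : ∀ i ∈ I, m + 1 ≤ (V.filter (fun v => 2 * m * Nat.choose (V.card - 2) r <
      ((F i).filter (fun e => v ∈ e)).card)).card) :
    RMx I F := by
  obtain ⟨v, hv, hinj⟩ := exists_sdr I (fun i => V.filter (fun v => 2 * m * Nat.choose (V.card - 2) r <
      ((F i).filter (fun e => v ∈ e)).card)) (by rw [hI]; exact hH)
  simp only [mem_filter] at hv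
  set W := I.image v with hW
  have hWc : W.card = m + 1 := by rw [hW, card_image_of_injOn hinj, hI]
  have hWV : W ⊆ V := by
    intro x hx
    obtain ⟨i, hi, rfl⟩ := mem_image.1 hx
    exact (hv i hi).1
  have hvW : ∀ i ∈ I, v i ∈ W := fun i hi => mem_image_of_mem v hi
  let G : ℕ → Finset (Finset ℕ) := fun i =>
    ((F i).filter (fun e => v i ∈ e)).filter (fun e => Disjoint e (W.erase (v i)))
  have hVW : (V \ W).card = V.card - (m + 1) := by rw [card_sdiff_of_subset hWV, hWc]
  have hGc : ∀ i ∈ I, m * Nat.choose (V.card - 2) r < (G i).card := by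
    intro i hi
    have a1 := meet_count ((F i).filter (fun e => v i ∈ e)) (W.erase (v i))
    have a2 := card_filter_add_card_filter_not (s := (F i).filter (fun e => v i ∈ e))
      (fun e => Disjoint e (W.erase (v i)))
    have a3 : ∑ u ∈ W.erase (v i), (((F i).filter (fun e => v i ∈ e)).filter (fun e => u ∈ e)).card
        ≤ m * Nat.choose (V.card - 2) r := by
      calc _ ≤ ∑ u ∈ W.erase (v i), Nat.choose (V.card - 2) r := by
            apply sum_le_sum
            intro u hu
            have := mem_erase.1 hu
            exact pair_le V r u (v i) (F i) (hv i hi).1 (hWV this.2) this.1 (hF i hi)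
        _ = _ := by
            rw [sum_const, smul_eq_mul, card_erase_of_mem (hvW i hi), hWc, Nat.add_sub_cancel]
    have a4 := (hv i hi).2
    have a5 : 2 * m * Nat.choose (V.card - 2) r = m * Nat.choose (V.card - 2) r + m * Nat.choose (V.card - 2) r := by ring
    change _ < (filter (fun e => Disjoint e (W.erase (v i))) ((F i).filter (fun e => v i ∈ e))).card
    omega
  have hG : ∀ i, ∀ e ∈ G i, e ∈ F i ∧ v i ∈ e ∧ Disjoint e (W.erase (v i)) := by
    intro i e he
    have he := mem_filter.1 he
    have h' := mem_filter.1 he.1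
    exact ⟨h'.1, h'.2, he.2⟩
  obtain ⟨g, h1, h2⟩ := ih I (V \ W) (fun i => (G i).image (fun e => e.erase (v i))) hI
    (by
      rw [hVW]
      have : 3 * (r + 1) ^ 2 * (m + 1) + (m + 1) ≤ 3 * (r + 2) ^ 2 * (m + 1) := by nlinarith [Nat.zero_le (r * m)]
      omega)
    (by
      intro i hi f hf
      obtain ⟨e, he, rfl⟩ := mem_image.1 hf
      obtain ⟨b1, b2, b3⟩ := hG i e he
      obtain ⟨c1, c2⟩ := hF i hi e b1
      constructor
      · intro x hx
        have hx := mem_erase.1 hx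
        refine mem_sdiff.2 ⟨c1 hx.2, fun hxW => ?_⟩
        exact disjoint_left.1 b3 hx.2 (mem_erase.2 ⟨hx.1, hxW⟩)
      · rw [card_erase_of_mem b2, c2]; rfl)
    (by
      intro i hi
      have d1 := hGc i hi
      have d2 : ((G i).image (fun e => e.erase (v i))).card = (G i).card := by
        apply card_image_of_injOn
        intro e he f hf hef
        have he := (hG i e he).2.1
        have hf := (hG i f hf).2.1
        simp only at hef
        rw [← insert_erase he, ← insert_erase hf, hef]
      rw [d2, hVW]
      have hbig : 2 * (m + 1) ≤ V.card := by nlinarith [Nat.zero_le (r * m)]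
      have d3 := choose_upper (V.card - (m + 1) - m) r (V.card - 2) m (by omega)
      have d4 : V.card - (m + 1) - m + m = V.card - (m + 1) := by omega
      have d5 : V.card - (m + 1) - (m + 1) + 1 = V.card - (m + 1) - m := by omega
      rw [d4] at d3
      rw [d5]
      omega)
  have h3 : ∀ i ∈ I, ∃ e ∈ G i, e.erase (v i) = g i := fun i hi => mem_image.1 (h1 i hi)
  choose! e he1 he2 using h3
  refine ⟨e, fun i hi => (hG i _ (he1 i hi)).1, ?_⟩
  intro i hi j hj hij
  have hdis := h2 i hi j hj hij
  obtain ⟨-, p2, p3⟩ := hG i _ (he1 i hi)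
  obtain ⟨-, q2, q3⟩ := hG j _ (he1 j hj)
  have hne : v i ≠ v j := fun h => hij (hinj hi hj h)
  rw [← he2 i hi, ← he2 j hj] at hdis
  rw [disjoint_left]
  intro x hx hy
  by_cases hxi : x = v i
  · subst hxi
    exact disjoint_left.1 q3 hy (mem_erase.2 ⟨hne, hvW i hi⟩)
  · by_cases hxj : x = v j
    · subst hxj
      exact disjoint_left.1 p3 hx (mem_erase.2 ⟨hne.symm, hvW j hj⟩)
    · exact disjoint_left.1 hdis (mem_erase.2 ⟨hxi, hx⟩) (mem_erase.2 ⟨hxj, hy⟩)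

lemma stm_all (r : ℕ) : ∀ m, Stm (r + 1) m := by
  induction r with
  | zero => exact stm_one
  | succ r ihr =>
    intro m
    induction m with
    | zero => exact stm_zero _
    | succ m ih =>
      intro I V F hI hV hF hc
      by_cases hA : ∃ i ∈ I, ∃ v ∈ V, (m * (r + 2)) * Nat.choose (V.card - 2) r <
          ((F i).filter (fun e => v ∈ e)).card
      · obtain ⟨i, hi, v, hv, hd⟩ := hA
        exact caseA r m ih I V F hI hV hF hc i v hi hv hd
      · push Not at hA
        by_cases hB : ∀ i ∈ I, m + 1 ≤ (V.filter (fun v => 2 * m * Nat.choose (V.card - 2) r <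
            ((F i).filter (fun e => v ∈ e)).card)).card
        · exact caseB1 r m (ihr (m + 1)) I V F hI hV hF hB
        · push Not at hB
          obtain ⟨i, hi, hH⟩ := hB
          exact caseB2 r m ih I V F hI hV hF hc i hi (hA i hi) (by omega)

/-- the rainbow matching conjecture holds when `n > 3k²m`. -/
theorem rainbow_matching_of_large_n (n k m : ℕ) (hk : 0 < k) (hm : 0 < m)
    (hn : n > 3 * k ^ 2 * m)
    (F : Fin m → Finset (Finset ℕ)) (hF : ∀ i, IsKGraphOn n k (F i))
    (hcard : ∀ i, (F i).card > fEMC n m k) : HasRainbowMatching F := by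
  obtain ⟨r, rfl⟩ : ∃ r, k = r + 1 := ⟨k - 1, by omega⟩
  obtain ⟨e, h1, h2⟩ := stm_all r m (Finset.range m) (Finset.Icc 1 n)
    (fun i => if h : i < m then F ⟨i, h⟩ else ∅) (by simp) (by simpa using hn)
    (by
      intro i hi f hf
      have hi := Finset.mem_range.1 hi
      simp only [hi, dite_true] at hf
      exact hF _ f hf)
    (by
      intro i hi
      have hi := Finset.mem_range.1 hi
      simp only [hi, dite_true, Nat.card_Icc, Nat.add_sub_cancel]
      have := hcard ⟨i, hi⟩
      have h' : Nat.choose n (r + 1) - Nat.choose (n - m + 1) (r + 1) ≤ fEMC n m (r + 1) :=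
        le_max_left _ _
      omega)
  refine ⟨fun i => e i, ?_, ?_⟩
  · intro i
    have := h1 i (Finset.mem_range.2 i.2)
    simpa using this
  · intro i j hij
    exact h2 i (Finset.mem_range.2 i.2) j (Finset.mem_range.2 j.2) (fun h => hij (Fin.ext h))
end

section
/- For every positive integer k there exists c₀ > 0 such that for every real c with 0 < c < c₀ there exists γ₀ > 0 such that for every real γ with 0 < γ < γ₀ there exists γ'₀ > 0 such that for every real γ' with 0 < γ' < γ'₀ there exists n₀ such that the following holds for all integers n ≥ n₀ and m with n/(3k²) ≤ m ≤ (1−c)n/k: if F = {F_1, ..., F_m} is a stable family of k-graphs on vertex set [n] with |F_i| > f(n,m,k) for every i ∈ [m], then H*(F) has a matching M with |M| ≤ γn such that for every set S ⊆ V(H*(F)) \ V(M) with |S| ≤ γ'n and k·|S ∩ (V ∪ U)| = |S ∩ [n]|, the subgraph of H*(F) induced on V(M) ∪ S has a perfect matching (a matching covering all vertices of that induced subgraph). -/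
open Finset

/-- Perfect matching between labels `A` and blocks of `X`, when all edges are available. -/
lemma assign_matching (H : Finset (Finset ℕ)) (k : ℕ) (A : Finset ℕ) :
    ∀ X : Finset ℕ, X.card = k * A.card → Disjoint A X →
      (∀ a ∈ A, ∀ e ⊆ X, e.card = k → insert a e ∈ H) →
      ∃ M ⊆ H, IsMatching M ∧ M.biUnion id = A ∪ X ∧ M.card ≤ A.card := by
  induction A using Finset.induction_on with
  | empty =>
    intro X hX _ _
    have : X = ∅ := by simpa using hX
    subst this
    exact ⟨∅, by simp, by simp [IsMatching], by simp, by simp⟩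
  | insert a A ha ih =>
    intro X hX hd hH
    rw [card_insert_of_notMem ha] at hX
    obtain ⟨Y, hYX, hY⟩ := exists_subset_card_eq (s := X) (n := k) (by rw [hX]; nlinarith)
    have hc : (X \ Y).card = k * A.card := by
      rw [card_sdiff_of_subset hYX, hX, hY, Nat.mul_succ]; omega
    rw [disjoint_insert_left] at hd
    obtain ⟨M, hMH, hM, hMU, hMc⟩ := ih (X \ Y) hc (hd.2.mono_right sdiff_subset)
      (fun b hb e he hek => hH b (mem_insert_of_mem hb) e (he.trans sdiff_subset) hek)
    have key : ∀ e ∈ M, Disjoint (insert a Y) e := by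
      intro e he
      have hsub : e ⊆ A ∪ (X \ Y) := by
        rw [← hMU]; exact subset_biUnion_of_mem id he
      refine Disjoint.mono_right hsub ?_
      rw [Finset.disjoint_left]
      intro x hx hx2
      have h3 := Finset.disjoint_left.mp hd.2
      simp only [mem_insert, mem_union, mem_sdiff] at hx hx2
      rcases hx with rfl | hx
      · rcases hx2 with h | h
        · exact ha h
        · exact hd.1 h.1
      · rcases hx2 with h | h
        · exact h3 h (hYX hx)
        · exact h.2 hx
    refine ⟨insert (insert a Y) M, ?_, ?_, ?_, ?_⟩
    · intro e he
      rcases mem_insert.mp he with rfl | he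
      · exact hH a (mem_insert_self _ _) Y hYX hY
      · exact hMH he
    · intro e he f hf hef
      rcases mem_insert.mp he with rfl | he <;> rcases mem_insert.mp hf with rfl | hf
      · exact absurd rfl hef
      · exact key f hf
      · exact (key e he).symm
      · exact hM e he f hf hef
    · rw [biUnion_insert, hMU]
      ext x
      have := @hYX x
      simp only [id, mem_union, mem_insert, mem_sdiff]
      tauto
    · rw [card_insert_of_notMem ha]
      exact (card_insert_le _ _).trans (by omega)

lemma matching_union {M N : Finset (Finset ℕ)} (hM : IsMatching M) (hN : IsMatching N)
    (h : Disjoint (M.biUnion id) (N.biUnion id)) : IsMatching (M ∪ N) := by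
  intro e he f hf hef
  rcases mem_union.mp he with he | he <;> rcases mem_union.mp hf with hf | hf
  · exact hM e he f hf hef
  · exact h.mono (subset_biUnion_of_mem id he) (subset_biUnion_of_mem id hf)
  · exact (h.mono (subset_biUnion_of_mem id hf) (subset_biUnion_of_mem id he)).symm
  · exact hN e he f hf hef

/-- A stable `k`-graph with more than `f(n,m,k)` edges contains all `k`-subsets of `[m]`. -/
lemma corner (n m k : ℕ) (hm : 0 < m) (hmn : m ≤ n) (F : Finset (Finset ℕ))
    (hF : IsKGraphOn n k F) (hs : StableGraph n F) (hc : F.card > fEMC n m k)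
    (e : Finset ℕ) (he : e ⊆ Icc 1 m) (hek : e.card = k) : e ∈ F := by
  obtain ⟨f, hf, hfm⟩ : ∃ f ∈ F, f ⊆ Icc m n := by
    by_contra hcon
    push Not at hcon
    have hsub : F ⊆ (Icc 1 n).powersetCard k \ (Icc m n).powersetCard k := by
      intro f hf
      rw [mem_sdiff, mem_powersetCard, mem_powersetCard]
      exact ⟨hF f hf, fun h => hcon f hf h.1⟩
    have h1 := card_le_card hsub
    rw [card_sdiff_of_subset (powersetCard_mono (Icc_subset_Icc_left hm)),
      card_powersetCard, card_powersetCard, Nat.card_Icc, Nat.card_Icc] at h1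
    have h2 : n.choose k - (n - m + 1).choose k ≤ fEMC n m k := le_max_left _ _
    have h3 : n + 1 - m = n - m + 1 := by omega
    rw [h3, Nat.add_sub_cancel] at h1
    omega
  refine hs e f (he.trans (Icc_subset_Icc_right hmn)) ?_ hf
  unfold DomLE
  rw [List.forall₂_iff_get]
  refine ⟨by simp [hek, (hF f hf).2], ?_⟩
  intro i h1 h2
  have ha : (e.sort (· ≤ ·)).get ⟨i, h1⟩ ∈ e := by
    rw [← mem_sort (· ≤ ·)]; exact List.get_mem _ _
  have hb : (f.sort (· ≤ ·)).get ⟨i, h2⟩ ∈ f := by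
    rw [← mem_sort (· ≤ ·)]; exact List.get_mem _ _
  exact (mem_Icc.mp (he ha)).2.trans (mem_Icc.mp (hfm hb)).1

lemma mem_Hstar_U (n k m : ℕ) (F : Fin m → Finset (Finset ℕ)) (a : ℕ)
    (ha : a ∈ Icc (n + m + 1) (n + m + (n / k - m))) (e : Finset ℕ) (he : e ⊆ Icc 1 n)
    (hek : e.card = k) : insert a e ∈ HstarF n k F := by
  rw [mem_Icc] at ha
  refine mem_union_right _ (mem_biUnion.mpr ⟨⟨a - (n + m + 1), by omega⟩, mem_univ _, ?_⟩)
  refine mem_image.mpr ⟨e, mem_powersetCard.mpr ⟨he, hek⟩, ?_⟩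
  congr 1
  simp only
  omega

lemma mem_Hstar_V (n k m : ℕ) (F : Fin m → Finset (Finset ℕ)) (a : ℕ)
    (ha : a ∈ Icc (n + 1) (n + m)) (e : Finset ℕ) (he : ∀ i, e ∈ F i) :
    insert a e ∈ HstarF n k F := by
  rw [mem_Icc] at ha
  refine mem_union_left _ (mem_biUnion.mpr ⟨⟨a - (n + 1), by omega⟩, mem_univ _, ?_⟩)
  refine mem_image.mpr ⟨e, he _, ?_⟩
  congr 1
  simp only
  omega

/-- The combinatorial core. -/
lemma absorb_core (n m k t : ℕ) (hk : 0 < k) (hm : 0 < m) (hmn : m ≤ n) (htm : k * t ≤ m)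
    (htr : t ≤ n / k - m)
    (F : Fin m → Finset (Finset ℕ)) (hF : ∀ i, IsKGraphOn n k (F i))
    (hs : ∀ i, StableGraph n (F i)) (hc : ∀ i, (F i).card > fEMC n m k) :
    ∃ M ⊆ HstarF n k F, IsMatching M ∧ M.card ≤ t ∧
      ∀ S ⊆ Finset.Icc 1 (n + m + (n / k - m)) \ M.biUnion id,
        S.card ≤ t →
        k * (S ∩ Finset.Icc (n + 1) (n + m + (n / k - m))).card
            = (S ∩ Finset.Icc 1 n).card →
        ∃ M' ⊆ HstarF n k F, IsMatching M' ∧ M'.biUnion id = M.biUnion id ∪ S := by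
  generalize hr : n / k - m = r at htr
  have hU : ∀ a ∈ Icc (n + m + 1) (n + m + r), ∀ e ⊆ Icc 1 n, e.card = k →
      insert a e ∈ HstarF n k F := by
    intro a ha e he hek
    exact mem_Hstar_U n k m F a (by rwa [hr]) e he hek
  have hV : ∀ a ∈ Icc (n + 1) (n + m), ∀ e ⊆ Icc 1 m, e.card = k →
      insert a e ∈ HstarF n k F := by
    intro a ha e he hek
    exact mem_Hstar_V n k m F a ha e
      (fun i => corner n m k hm hmn (F i) (hF i) (hs i) (hc i) e he hek)
  obtain ⟨M, hMH, hM, hMU, hMc⟩ := assign_matching (HstarF n k F) k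
    (Icc (n + m + 1) (n + m + t)) (Icc 1 (k * t)) (by simp)
    (by rw [Finset.disjoint_left]; intro x; simp only [mem_Icc]; omega)
    (fun a ha e he hek => hU a (Icc_subset_Icc_right (by omega) ha) e
      (he.trans (Icc_subset_Icc_right (by omega))) hek)
  refine ⟨M, hMH, hM, by simpa using hMc, ?_⟩
  intro S hS hSc hbal
  rw [hMU] at hS ⊢
  have hSm : ∀ x ∈ S, 1 ≤ x ∧ x ≤ n + m + r ∧ ¬ (n + m + 1 ≤ x ∧ x ≤ n + m + t) ∧
      ¬ (x ≤ k * t) := by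
    intro x hx
    have := hS hx
    simp only [mem_sdiff, mem_union, mem_Icc] at this
    omega
  -- the three parts of S
  set SV := S ∩ Icc (n + 1) (n + m) with hSV
  set SU := S ∩ Icc (n + m + 1) (n + m + r) with hSU
  set SX := S ∩ Icc 1 n with hSX
  have hsplit : S ∩ Icc (n + 1) (n + m + r) = SV ∪ SU := by
    ext x; simp only [hSV, hSU, mem_inter, mem_union, mem_Icc]
    constructor
    · rintro ⟨h1, h2⟩
      by_cases h : x ≤ n + m
      · exact Or.inl ⟨h1, by omega⟩
      · exact Or.inr ⟨h1, by omega⟩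
    · rintro (⟨h1, h2⟩ | ⟨h1, h2⟩) <;> exact ⟨h1, by omega⟩
  have hdUV : Disjoint SV SU := by
    rw [Finset.disjoint_left]; intro x
    simp only [hSV, hSU, mem_inter, mem_Icc]; omega
  rw [hsplit, card_union_of_disjoint hdUV] at hbal
  have hst : SV.card ≤ t := (card_le_card inter_subset_left).trans hSc
  generalize hsv : SV.card = s at hst hbal
  have hkst : k * s ≤ k * t := Nat.mul_le_mul_left k hst
  obtain ⟨M1, hM1H, hM1, hM1U, -⟩ := assign_matching (HstarF n k F) k
    SV (Icc 1 (k * s)) (by simp [hsv])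
    (by rw [Finset.disjoint_left]; intro x; simp only [hSV, mem_inter, mem_Icc]; omega)
    (fun a ha e he hek => hV a (mem_inter.mp ha).2 e
      (he.trans (Icc_subset_Icc_right (by omega))) hek)
  have hd1 : Disjoint SU (Icc (n + m + 1) (n + m + t)) := by
    rw [Finset.disjoint_left]; intro x hx hx2
    have := hSm x (mem_inter.mp hx).1
    rw [mem_Icc] at hx2
    omega
  have hd2 : Disjoint SX (Icc (k * s + 1) (k * t)) := by
    rw [Finset.disjoint_left]; intro x hx hx2
    have := hSm x (mem_inter.mp hx).1
    rw [mem_Icc] at hx2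
    omega
  obtain ⟨M2, hM2H, hM2, hM2U, -⟩ := assign_matching (HstarF n k F) k
    (SU ∪ Icc (n + m + 1) (n + m + t)) (SX ∪ Icc (k * s + 1) (k * t))
    (by
      rw [card_union_of_disjoint hd1, card_union_of_disjoint hd2, ← hbal]
      simp only [Nat.card_Icc]
      have e1 : n + m + t + 1 - (n + m + 1) = t := by omega
      have e2 : k * t + 1 - (k * s + 1) = k * t - k * s := by omega
      rw [e1, e2, Nat.mul_add, Nat.mul_add]
      omega)
    (by
      rw [Finset.disjoint_left]; intro x
      simp only [hSU, hSX, mem_union, mem_inter, mem_Icc]; omega)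
    (fun a ha e he hek => hU a
      (by
        rcases mem_union.mp ha with ha | ha
        · exact (mem_inter.mp ha).2
        · exact Icc_subset_Icc_right (by omega) ha) e
      (he.trans (union_subset inter_subset_right
        (Icc_subset_Icc (by omega) (by omega)))) hek)
  refine ⟨M1 ∪ M2, union_subset hM1H hM2H, matching_union hM1 hM2 ?_, ?_⟩
  · rw [hM1U, hM2U, Finset.disjoint_left]
    intro x hx hx2
    simp only [hSV, hSU, hSX, mem_union, mem_inter, mem_Icc] at hx hx2
    have := hSm x
    by_cases hxS : x ∈ S
    · have := hSm x hxS
      omega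
    · simp only [hxS, false_and, false_or] at hx hx2
      omega
  · have : (M1 ∪ M2).biUnion id = M1.biUnion id ∪ M2.biUnion id := by
      ext x; simp only [mem_biUnion, mem_union]
      constructor
      · rintro ⟨e, he | he, hx⟩
        · exact Or.inl ⟨e, he, hx⟩
        · exact Or.inr ⟨e, he, hx⟩
      · rintro (⟨e, he, hx⟩ | ⟨e, he, hx⟩)
        · exact ⟨e, Or.inl he, hx⟩
        · exact ⟨e, Or.inr he, hx⟩
    rw [this, hM1U, hM2U]
    ext x
    simp only [hSV, hSU, hSX, mem_union, mem_inter, mem_Icc]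
    by_cases hxS : x ∈ S
    · have := hSm x hxS
      simp only [hxS, true_and, or_true, iff_true]
      omega
    · simp only [hxS, false_and, false_or, or_false]
      omega

/-- absorbing matching in `H*(F)`. -/
theorem absorbing_matching (k : ℕ) (hk : 0 < k) :
    ∃ c₀ : ℝ, 0 < c₀ ∧ ∀ c : ℝ, 0 < c → c < c₀ →
      ∃ γ₀ : ℝ, 0 < γ₀ ∧ ∀ γ : ℝ, 0 < γ → γ < γ₀ →
        ∃ γ'₀ : ℝ, 0 < γ'₀ ∧ ∀ γ' : ℝ, 0 < γ' → γ' < γ'₀ →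
          ∃ n₀ : ℕ, ∀ n : ℕ, n ≥ n₀ → ∀ m : ℕ, 0 < m →
            (n : ℝ) / (3 * (k : ℝ) ^ 2) ≤ (m : ℝ) → (m : ℝ) ≤ (1 - c) * n / k →
            ∀ F : Fin m → Finset (Finset ℕ), (∀ i, IsKGraphOn n k (F i)) →
              (∀ i, StableGraph n (F i)) → (∀ i, (F i).card > fEMC n m k) →
              ∃ M ⊆ HstarF n k F, IsMatching M ∧ (M.card : ℝ) ≤ γ * n ∧
                ∀ S ⊆ Finset.Icc 1 (n + m + (n / k - m)) \ M.biUnion id,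
                  (S.card : ℝ) ≤ γ' * n →
                  k * (S ∩ Finset.Icc (n + 1) (n + m + (n / k - m))).card
                      = (S ∩ Finset.Icc 1 n).card →
                  ∃ M' ⊆ HstarF n k F, IsMatching M' ∧
                    M'.biUnion id = M.biUnion id ∪ S := by
  refine ⟨1, one_pos, fun c hc hc1 => ⟨1, one_pos, fun γ hγ _ => ?_⟩⟩
  have hk0 : (0 : ℝ) < k := by exact_mod_cast hk
  refine ⟨min γ (min (1 / (3 * (k : ℝ) ^ 3)) (c / (2 * k))), by positivity, ?_⟩
  intro γ' hγ' hlt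
  rw [lt_min_iff, lt_min_iff] at hlt
  obtain ⟨h1, h2, h3⟩ := hlt
  refine ⟨⌈2 * (k : ℝ) / c⌉₊, ?_⟩
  intro n hn m hm hm1 hm2 F hF hs hcard
  have hnr : 2 * (k : ℝ) / c ≤ n := Nat.ceil_le.mp hn
  have hn0 : (0 : ℝ) < n := lt_of_lt_of_le (by positivity) hnr
  have hcn : 2 * (k : ℝ) ≤ c * n := by
    rw [div_le_iff₀ hc] at hnr; linarith
  have hk1 : (1 : ℝ) ≤ k := by exact_mod_cast hk
  have hmn : m ≤ n := by
    have : (m : ℝ) ≤ n := by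
      refine hm2.trans ?_
      rw [div_le_iff₀ hk0]
      nlinarith
    exact_mod_cast this
  have ht : ((⌊γ' * n⌋₊ : ℕ) : ℝ) ≤ γ' * n := Nat.floor_le (by positivity)
  have htm : k * ⌊γ' * n⌋₊ ≤ m := by
    have : ((k * ⌊γ' * n⌋₊ : ℕ) : ℝ) ≤ m := by
      refine le_trans ?_ hm1
      push_cast
      calc (k : ℝ) * ⌊γ' * n⌋₊ ≤ k * (γ' * n) := by gcongr
        _ ≤ k * (1 / (3 * (k : ℝ) ^ 3) * n) := by gcongr
        _ = n / (3 * (k : ℝ) ^ 2) := by field_simp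
    exact_mod_cast this
  have htr : ⌊γ' * n⌋₊ ≤ n / k - m := by
    have h : ⌊γ' * n⌋₊ + m ≤ n / k := by
      rw [Nat.le_div_iff_mul_le hk]
      have : (((⌊γ' * n⌋₊ + m) * k : ℕ) : ℝ) ≤ n := by
        push_cast
        have a1 : (⌊γ' * n⌋₊ : ℝ) * k ≤ c / 2 * n := by
          calc (⌊γ' * n⌋₊ : ℝ) * k ≤ (γ' * n) * k := by gcongr
            _ ≤ (c / (2 * k) * n) * k := by gcongr
            _ = c / 2 * n := by field_simp
        have a2 : (m : ℝ) * k ≤ (1 - c) * n := by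
          rwa [le_div_iff₀ hk0] at hm2
        nlinarith
      exact_mod_cast this
    omega
  obtain ⟨M, hMH, hM, hMc, habs⟩ :=
    absorb_core n m k ⌊γ' * n⌋₊ hk hm hmn htm htr F hF hs hcard
  refine ⟨M, hMH, hM, ?_, ?_⟩
  · calc (M.card : ℝ) ≤ ⌊γ' * n⌋₊ := by exact_mod_cast hMc
      _ ≤ γ' * n := ht
      _ ≤ γ * n := by gcongr
  · intro S hS hSc hbal
    exact habs S hS (Nat.le_floor hSc) hbal
end

section
/- For every integer k ≥ 2 and every real σ > 0, there exist τ > 0 and d₀ such that for every pair of integers n ≥ D ≥ d₀ the following holds: every n-vertex k-graph H in which every vertex v satisfies (1−τ)D < d_H(v) < (1+τ)D and in which Δ₂(H) < τD contains a matching covering all but at most σn vertices of H. -/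
open Finset

namespace FR

lemma one_sub_sum_le {ι : Type*} (s : Finset ι) (x : ι → ℝ)
    (h0 : ∀ i ∈ s, 0 ≤ x i) (h1 : ∀ i ∈ s, x i ≤ 1) :
    1 - ∑ i ∈ s, x i ≤ ∏ i ∈ s, (1 - x i) := by
  classical
  induction s using Finset.induction_on with
  | empty => simp
  | insert a s ha ih =>
    rw [Finset.sum_insert ha, Finset.prod_insert ha]
    have ih' := ih (fun i hi => h0 i (Finset.mem_insert_of_mem hi))
      (fun i hi => h1 i (Finset.mem_insert_of_mem hi))
    have a0 := h0 a (Finset.mem_insert_self _ _)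
    have a1 := h1 a (Finset.mem_insert_self _ _)
    have s0 : 0 ≤ ∑ i ∈ s, x i :=
      Finset.sum_nonneg (fun i hi => h0 i (Finset.mem_insert_of_mem hi))
    nlinarith [mul_le_mul_of_nonneg_left ih' (sub_nonneg.2 a1), mul_nonneg a0 s0]

lemma prod_one_sub_nonneg {ι : Type*} (s : Finset ι) (x : ι → ℝ)
    (h1 : ∀ i ∈ s, x i ≤ 1) : 0 ≤ ∏ i ∈ s, (1 - x i) :=
  Finset.prod_nonneg (fun i hi => sub_nonneg.2 (h1 i hi))

lemma prod_one_sub_le_one {ι : Type*} (s : Finset ι) (x : ι → ℝ)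
    (h0 : ∀ i ∈ s, 0 ≤ x i) (h1 : ∀ i ∈ s, x i ≤ 1) : ∏ i ∈ s, (1 - x i) ≤ 1 :=
  Finset.prod_le_one (fun i hi => sub_nonneg.2 (h1 i hi)) (fun i hi => by linarith [h0 i hi])

/-- Probability of the outcome `S` of independent selections with probabilities `p`. -/
noncomputable def pr {ι : Type*} [DecidableEq ι] (H : Finset ι) (p : ι → ℝ) (S : Finset ι) : ℝ :=
  (∏ e ∈ S, p e) * ∏ e ∈ H \ S, (1 - p e)

lemma pr_nonneg {ι : Type*} [DecidableEq ι] (H : Finset ι) (p : ι → ℝ) (S : Finset ι) (hS : S ⊆ H)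
    (h0 : ∀ i ∈ H, 0 ≤ p i) (h1 : ∀ i ∈ H, p i ≤ 1) : 0 ≤ pr H p S :=
  mul_nonneg (Finset.prod_nonneg fun i hi => h0 i (hS hi))
    (prod_one_sub_nonneg _ _ fun i hi => h1 i (Finset.mem_sdiff.1 hi).1)

lemma pr_avoid {ι : Type*} [DecidableEq ι] (H : Finset ι) (p : ι → ℝ) (A : Finset ι) (hA : A ⊆ H) :
    ∑ S ∈ H.powerset, pr H p S * (if Disjoint S A then 1 else 0) = ∏ e ∈ A, (1 - p e) := by
  have h := Finset.prod_add (fun e => if e ∈ A then 0 else p e) (fun e => 1 - p e) H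
  have h2 : ∏ e ∈ H, ((if e ∈ A then 0 else p e) + (1 - p e)) = ∏ e ∈ A, (1 - p e) := by
    rw [← Finset.prod_subset hA (f := fun e => (if e ∈ A then 0 else p e) + (1 - p e))]
    · exact Finset.prod_congr rfl (fun e he => by simp [he])
    · intro e _ he
      simp [he]
  rw [← h2, h]
  refine Finset.sum_congr rfl fun S _ => ?_
  unfold pr
  split_ifs with hd
  · rw [mul_one]
    congr 1
    refine Finset.prod_congr rfl fun e he => ?_
    rw [if_neg (Finset.disjoint_left.1 hd he)]
  · rw [Finset.not_disjoint_iff] at hd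
    obtain ⟨e, he, hea⟩ := hd
    have hz : ∏ i ∈ S, (if i ∈ A then 0 else p i) = 0 := Finset.prod_eq_zero he (if_pos hea)
    rw [hz]
    simp

lemma pr_total {ι : Type*} [DecidableEq ι] (H : Finset ι) (p : ι → ℝ) :
    ∑ S ∈ H.powerset, pr H p S = 1 := by
  simpa using pr_avoid H p ∅ (Finset.empty_subset _)

lemma pr_sel {ι : Type*} [DecidableEq ι] (H : Finset ι) (p : ι → ℝ) (A : Finset ι) (hA : A ⊆ H)
    (e : ι) (he : e ∈ H) (heA : e ∉ A) :
    ∑ S ∈ H.powerset, pr H p S * (if e ∈ S ∧ Disjoint S A then 1 else 0)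
      = p e * ∏ f ∈ A, (1 - p f) := by
  have h1 := pr_avoid H p A hA
  have h2 := pr_avoid H p (insert e A) (Finset.insert_subset he hA)
  rw [Finset.prod_insert heA] at h2
  have : ∑ S ∈ H.powerset, pr H p S * (if e ∈ S ∧ Disjoint S A then 1 else 0)
    = ∑ S ∈ H.powerset, pr H p S * (if Disjoint S A then 1 else 0)
      - ∑ S ∈ H.powerset, pr H p S * (if Disjoint S (insert e A) then 1 else 0) := by
    rw [← Finset.sum_sub_distrib]
    refine Finset.sum_congr rfl fun S _ => ?_
    simp only [Finset.disjoint_insert_right]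
    by_cases h : e ∈ S <;> by_cases h' : Disjoint S A <;> simp [h, h']
  rw [this, h1, h2]
  ring

/-- Variance bound. -/
lemma var_bound {ι κ : Type*} [DecidableEq ι] (H : Finset ι) (p : ι → ℝ)
    (h0 : ∀ i ∈ H, 0 ≤ p i) (h1 : ∀ i ∈ H, p i ≤ 1)
    (L : Finset κ) (b : κ → ℝ) (hb : ∀ e ∈ L, 0 ≤ b e) (A : κ → Finset ι) (hA : ∀ e ∈ L, A e ⊆ H) :
    ∑ S ∈ H.powerset, pr H p S * ((∑ e ∈ L, b e * (if Disjoint S (A e) then 1 else 0))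
        - ∑ e ∈ L, b e * ∏ f ∈ A e, (1 - p f)) ^ 2
      ≤ ∑ e ∈ L, ∑ e' ∈ L, b e * b e' * ∑ f ∈ A e ∩ A e', p f := by
  set μ := ∑ e ∈ L, b e * ∏ f ∈ A e, (1 - p f) with hμ
  have e1 : ∑ S ∈ H.powerset, pr H p S * (∑ e ∈ L, b e * (if Disjoint S (A e) then 1 else 0)) = μ := by
    simp_rw [Finset.mul_sum]
    rw [Finset.sum_comm]
    refine Finset.sum_congr rfl fun e he => ?_
    rw [← pr_avoid H p (A e) (hA e he), Finset.mul_sum]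
    exact Finset.sum_congr rfl fun S _ => by ring
  have e2 : ∑ S ∈ H.powerset, pr H p S * (∑ e ∈ L, b e * (if Disjoint S (A e) then 1 else 0)) ^ 2
      = ∑ e ∈ L, ∑ e' ∈ L, b e * b e' * ∏ f ∈ A e ∪ A e', (1 - p f) := by
    simp_rw [sq, Finset.sum_mul_sum, Finset.mul_sum]
    rw [Finset.sum_comm]
    refine Finset.sum_congr rfl fun e he => ?_
    rw [Finset.sum_comm]
    refine Finset.sum_congr rfl fun e' he' => ?_
    rw [← pr_avoid H p _ (Finset.union_subset (hA e he) (hA e' he')), Finset.mul_sum]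
    refine Finset.sum_congr rfl fun S _ => ?_
    simp only [Finset.disjoint_union_right]
    by_cases h : Disjoint S (A e) <;> by_cases h' : Disjoint S (A e') <;> simp [h, h'] ; ring
  have e3 : ∑ S ∈ H.powerset, pr H p S * ((∑ e ∈ L, b e * (if Disjoint S (A e) then 1 else 0)) - μ) ^ 2
      = (∑ e ∈ L, ∑ e' ∈ L, b e * b e' * ∏ f ∈ A e ∪ A e', (1 - p f)) - μ * μ := by
    have : ∀ S ∈ H.powerset,
      pr H p S * ((∑ e ∈ L, b e * (if Disjoint S (A e) then 1 else 0)) - μ) ^ 2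
      = pr H p S * (∑ e ∈ L, b e * (if Disjoint S (A e) then 1 else 0)) ^ 2
        - 2 * μ * (pr H p S * (∑ e ∈ L, b e * (if Disjoint S (A e) then 1 else 0)))
        + μ ^ 2 * pr H p S := fun S _ => by ring
    rw [Finset.sum_congr rfl this, Finset.sum_add_distrib, Finset.sum_sub_distrib,
      ← Finset.mul_sum, ← Finset.mul_sum, e1, e2, pr_total]
    ring
  rw [e3, hμ, Finset.sum_mul_sum, ← Finset.sum_sub_distrib]
  refine Finset.sum_le_sum fun e he => ?_
  rw [← Finset.sum_sub_distrib]
  refine Finset.sum_le_sum fun e' he' => ?_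
  have hui := Finset.prod_union_inter (s₁ := A e) (s₂ := A e') (f := fun f => 1 - p f)
  have hU : A e ∪ A e' ⊆ H := Finset.union_subset (hA e he) (hA e' he')
  have hI : A e ∩ A e' ⊆ H := Finset.inter_subset_left.trans (hA e he)
  have u0 := prod_one_sub_nonneg (A e ∪ A e') p (fun i hi => h1 i (hU hi))
  have u1 := prod_one_sub_le_one (A e ∪ A e') p (fun i hi => h0 i (hU hi)) (fun i hi => h1 i (hU hi))
  have i1 := one_sub_sum_le (A e ∩ A e') p (fun i hi => h0 i (hI hi)) (fun i hi => h1 i (hI hi))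
  have i0 : 0 ≤ ∑ f ∈ A e ∩ A e', p f := Finset.sum_nonneg (fun i hi => h0 i (hI hi))
  have key : ∏ f ∈ A e ∪ A e', (1 - p f) - (∏ f ∈ A e, (1 - p f)) * ∏ f ∈ A e', (1 - p f)
      ≤ ∑ f ∈ A e ∩ A e', p f := by
    rw [← hui]
    nlinarith
  have hbb := mul_nonneg (hb e he) (hb e' he')
  calc _ = b e * b e' * (∏ f ∈ A e ∪ A e', (1 - p f)
        - (∏ f ∈ A e, (1 - p f)) * ∏ f ∈ A e', (1 - p f)) := by ring
    _ ≤ _ := mul_le_mul_of_nonneg_left key hbb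

/-- weighted degree -/
noncomputable def wdeg (H : Finset (Finset ℕ)) (w : Finset ℕ → ℝ) (v : ℕ) : ℝ :=
  ∑ e ∈ H with v ∈ e, w e

lemma cover_bound (H B : Finset (Finset ℕ)) (g : Finset ℕ → ℝ) (hB : B ⊆ H)
    (hg : ∀ f ∈ H, 0 ≤ g f) (e : Finset ℕ) (hc : ∀ f ∈ B, ∃ v ∈ e, v ∈ f) :
    ∑ f ∈ B, g f ≤ ∑ v ∈ e, wdeg H g v := by
  have : ∑ v ∈ e, wdeg H g v = ∑ f ∈ H, ∑ v ∈ e, if v ∈ f then g f else 0 := by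
    rw [Finset.sum_comm]
    refine Finset.sum_congr rfl fun v _ => ?_
    rw [wdeg, Finset.sum_filter]
  rw [this]
  have nn : ∀ f ∈ H, ∀ v ∈ e, 0 ≤ if v ∈ f then g f else 0 := by
    intro f hf v _
    split_ifs
    · exact hg f hf
    · exact le_rfl
  calc ∑ f ∈ B, g f ≤ ∑ f ∈ B, ∑ v ∈ e, if v ∈ f then g f else 0 := by
        refine Finset.sum_le_sum fun f hf => ?_
        obtain ⟨v, hv, hvf⟩ := hc f hf
        have := Finset.single_le_sum (nn f (hB hf)) hv
        simpa [hvf] using this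
    _ ≤ _ := Finset.sum_le_sum_of_subset_of_nonneg hB
        (fun f hf _ => Finset.sum_nonneg (nn f hf))

lemma sum_edges_comm (V : Finset ℕ) (H : Finset (Finset ℕ)) (hV : ∀ e ∈ H, e ⊆ V)
    (w : Finset ℕ → ℝ) (g : ℕ → ℝ) :
    ∑ e ∈ H, w e * ∑ v ∈ e, g v = ∑ v ∈ V, wdeg H w v * g v := by
  unfold wdeg
  simp_rw [Finset.mul_sum, Finset.sum_mul]
  refine Finset.sum_comm' fun e v => ?_
  simp only [Finset.mem_filter]
  constructor
  · rintro ⟨h1, h2⟩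
    exact ⟨⟨h1, h2⟩, hV e h1 h2⟩
  · rintro ⟨⟨h1, h2⟩, _⟩
    exact ⟨h1, h2⟩

/-- Truncation of a weighting to a fractional matching. -/
lemma truncate (V : Finset ℕ) (H : Finset (Finset ℕ)) (hV : ∀ e ∈ H, e ⊆ V)
    (w : Finset ℕ → ℝ) (hw : ∀ e ∈ H, 0 ≤ w e) :
    ∃ w' : Finset ℕ → ℝ, (∀ e ∈ H, 0 ≤ w' e ∧ w' e ≤ w e) ∧ (∀ v ∈ V, wdeg H w' v ≤ 1) ∧
      ∑ e ∈ H, w e - ∑ v ∈ V, max 0 (wdeg H w v - 1) ≤ ∑ e ∈ H, w' e := by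
  set x : ℕ → ℝ := fun v => 1 - 1 / max 1 (wdeg H w v) with hx
  have m1 : ∀ v, 1 ≤ max 1 (wdeg H w v) := fun v => le_max_left _ _
  have x0 : ∀ v, 0 ≤ x v := fun v => by
    have := (div_le_one (by linarith [m1 v])).2 (m1 v)
    simp only [hx]; linarith
  have x1 : ∀ v, x v ≤ 1 := fun v => by
    have : 0 ≤ 1 / max 1 (wdeg H w v) := by have := m1 v; positivity
    simp only [hx]; linarith
  have xd : ∀ v, wdeg H w v * x v = max 0 (wdeg H w v - 1) := fun v => by
    simp only [hx]
    rcases le_total (wdeg H w v) 1 with h | h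
    · rw [max_eq_left h, max_eq_left (by linarith)]; simp
    · rw [max_eq_right h, max_eq_right (by linarith)]
      have : wdeg H w v ≠ 0 := by linarith
      field_simp
  refine ⟨fun e => w e * ∏ v ∈ e, (1 - x v), ?_, ?_, ?_⟩
  · intro e he
    have a := prod_one_sub_nonneg e x (fun i _ => x1 i)
    have b := prod_one_sub_le_one e x (fun i _ => x0 i) (fun i _ => x1 i)
    exact ⟨mul_nonneg (hw e he) a, mul_le_of_le_one_right (hw e he) b⟩
  · intro v _
    have : wdeg H (fun e => w e * ∏ v ∈ e, (1 - x v)) v ≤ wdeg H w v * (1 - x v) := by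
      unfold wdeg
      rw [Finset.sum_mul]
      refine Finset.sum_le_sum fun e he => ?_
      rw [Finset.mem_filter] at he
      refine mul_le_mul_of_nonneg_left ?_ (hw e he.1)
      rw [← Finset.mul_prod_erase e _ he.2]
      exact mul_le_of_le_one_right (by linarith [x1 v])
        (prod_one_sub_le_one _ x (fun i _ => x0 i) (fun i _ => x1 i))
    have h2 := xd v
    have : wdeg H w v * (1 - x v) ≤ 1 := by
      rw [mul_sub, h2]
      linarith [le_max_right 0 (wdeg H w v - 1)]
    linarith
  · have : ∑ v ∈ V, max 0 (wdeg H w v - 1) = ∑ e ∈ H, w e * ∑ v ∈ e, x v := by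
      rw [sum_edges_comm V H hV w x]
      exact Finset.sum_congr rfl fun v _ => (xd v).symm
    rw [this, ← Finset.sum_sub_distrib]
    refine Finset.sum_le_sum fun e he => ?_
    have := mul_le_mul_of_nonneg_left (one_sub_sum_le e x (fun i _ => x0 i) (fun i _ => x1 i)) (hw e he)
    linarith

lemma exists_ge {ι : Type*} [DecidableEq ι] (H : Finset ι) (p : ι → ℝ)
    (h0 : ∀ i ∈ H, 0 ≤ p i) (h1 : ∀ i ∈ H, p i ≤ 1) (X : Finset ι → ℝ) (T : ℝ)
    (hT : T ≤ ∑ S ∈ H.powerset, pr H p S * X S) : ∃ S ⊆ H, T ≤ X S := by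
  by_contra! hcon
  have nn : ∀ S ∈ H.powerset, 0 ≤ pr H p S * (T - X S) := fun S hS =>
    mul_nonneg (pr_nonneg H p S (Finset.mem_powerset.1 hS) h0 h1)
      (by linarith [hcon S (Finset.mem_powerset.1 hS)])
  have hsum : ∑ S ∈ H.powerset, pr H p S * (T - X S) = 0 := by
    refine le_antisymm ?_ (Finset.sum_nonneg nn)
    simp_rw [mul_sub]
    rw [Finset.sum_sub_distrib, ← Finset.sum_mul, pr_total]
    linarith
  rw [Finset.sum_eq_zero_iff_of_nonneg nn] at hsum
  have : ∑ S ∈ H.powerset, pr H p S = 0 := Finset.sum_eq_zero fun S hS => by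
    have h := hsum S hS
    have h' := hcon S (Finset.mem_powerset.1 hS)
    rcases mul_eq_zero.1 h with h | h
    · exact h
    · linarith
  rw [pr_total] at this
  exact one_ne_zero this

/-- The nibble. -/
lemma step (k : ℕ) (hk : 1 ≤ k) (ε : ℝ) (hε : 0 < ε) (hkε : k * ε ≤ 1 / 2)
    (c : ℝ) (hc : 0 ≤ c) (t : ℝ) (ht : 0 < t) (δ : ℝ) (hδ : 0 ≤ δ)
    (V : Finset ℕ) (H : Finset (Finset ℕ)) (hV : ∀ e ∈ H, e ⊆ V) (hcard : ∀ e ∈ H, e.card = k)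
    (w : Finset ℕ → ℝ) (hw : ∀ e ∈ H, 0 ≤ w e) (hdeg : ∀ v ∈ V, wdeg H w v ≤ 1)
    (hco : ∀ u ∈ V, ∀ v ∈ V, u ≠ v → ∑ e ∈ H with (u ∈ e ∧ v ∈ e), w e ≤ δ) :
    ∃ M ⊆ H, IsMatching M ∧ ∃ H' ⊆ H, (∀ e ∈ M, ∀ f ∈ H', Disjoint e f) ∧
      ∃ w' : Finset ℕ → ℝ, (∀ e ∈ H', 0 ≤ w' e ∧ w' e ≤ 2 * w e) ∧
        (∀ v ∈ V, wdeg H' w' v ≤ 1) ∧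
        (ε * (1 - k * ε) + c * (1 - ε)) * ∑ e ∈ H, w e - c * (4 * k ^ 2 * ε * δ / t + t) * V.card
          ≤ M.card + c * ∑ e ∈ H', w' e := by
  have hk1 : (1 : ℝ) ≤ k := by exact_mod_cast hk
  have hε2 : ε ≤ 1 / 2 := by nlinarith
  have hne : ∀ e ∈ H, e.Nonempty := fun e he => by
    rw [← Finset.card_pos, hcard e he]; omega
  have hw1 : ∀ e ∈ H, w e ≤ 1 := fun e he => by
    obtain ⟨v, hv⟩ := hne e he
    refine le_trans ?_ (hdeg v (hV e he hv))
    exact Finset.single_le_sum (f := w) (fun f hf => hw f (Finset.mem_filter.1 hf).1)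
      (Finset.mem_filter.2 ⟨he, hv⟩)
  obtain ⟨p, hp⟩ : ∃ p : Finset ℕ → ℝ, p = fun e => ε * w e := ⟨_, rfl⟩
  have p0 : ∀ e ∈ H, 0 ≤ p e := fun e he => by rw [hp]; exact mul_nonneg hε.le (hw e he)
  have p1 : ∀ e ∈ H, p e ≤ 1 := fun e he => by
    have := hw1 e he; have := hw e he; rw [hp]; simp only; nlinarith
  have pdeg : ∀ v ∈ V, wdeg H p v ≤ ε := fun v hv => by
    have : wdeg H p v = ε * wdeg H w v := by
      unfold wdeg; rw [hp, Finset.mul_sum]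
    rw [this]; nlinarith [hdeg v hv]
  -- neighbourhoods
  obtain ⟨nb, hnb⟩ : ∃ nb : Finset ℕ → Finset (Finset ℕ),
    nb = fun e => H.filter (fun f => ¬ Disjoint f e) := ⟨_, rfl⟩
  have nbH : ∀ e, nb e ⊆ H := fun e => by rw [hnb]; exact Finset.filter_subset _ _
  have mem_nb : ∀ e f, f ∈ nb e ↔ f ∈ H ∧ ¬ Disjoint f e := fun e f => by
    rw [hnb]; exact Finset.mem_filter
  have nbsum : ∀ e ∈ H, ∀ B ⊆ nb e, ∑ f ∈ B, p f ≤ k * ε := fun e he B hB => by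
    refine (cover_bound H B p (hB.trans (nbH e)) p0 e fun f hf => ?_).trans ?_
    · have := ((mem_nb e f).1 (hB hf)).2
      rw [Finset.not_disjoint_iff] at this
      obtain ⟨v, h1, h2⟩ := this
      exact ⟨v, h2, h1⟩
    · calc _ ≤ ∑ v ∈ e, ε := Finset.sum_le_sum fun v hv => pdeg v (hV e he hv)
        _ = k * ε := by rw [Finset.sum_const, hcard e he, nsmul_eq_mul]
  obtain ⟨s, hs⟩ : ∃ s : Finset ℕ → ℝ, s = fun e => ∏ f ∈ nb e, (1 - p f) := ⟨_, rfl⟩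
  have prodlb : ∀ e ∈ H, ∀ B ⊆ nb e, 1 - k * ε ≤ ∏ f ∈ B, (1 - p f) := fun e he B hB => by
    have := one_sub_sum_le B p (fun f hf => p0 f (nbH e (hB hf))) (fun f hf => p1 f (nbH e (hB hf)))
    linarith [nbsum e he B hB]
  have slb : ∀ e ∈ H, 1 / 2 ≤ s e := fun e he => by
    have := prodlb e he _ (Finset.Subset.refl _)
    rw [hs]; simp only; linarith
  obtain ⟨b, hb⟩ : ∃ b : Finset ℕ → ℝ, b = fun e => w e * ((1 - ε) / s e) := ⟨_, rfl⟩
  have b0 : ∀ e ∈ H, 0 ≤ b e := fun e he => by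
    rw [hb]
    exact mul_nonneg (hw e he) (div_nonneg (by linarith) (by linarith [slb e he]))
  have b2 : ∀ e ∈ H, b e ≤ 2 * w e := fun e he => by
    have h := slb e he
    have : (1 - ε) / s e ≤ 2 := by rw [div_le_iff₀ (by linarith)]; linarith
    rw [hb]; simp only; nlinarith [hw e he]
  have bs : ∀ e ∈ H, b e * s e = (1 - ε) * w e := fun e he => by
    have h := slb e he
    have : s e ≠ 0 := by linarith
    rw [hb]; simp only; field_simp
  -- conditional neighbourhoods
  obtain ⟨A, hA⟩ : ∃ A : ℕ → Finset ℕ → Finset (Finset ℕ),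
    A = fun v e => H.filter (fun f => v ∉ f ∧ ¬ Disjoint f e) := ⟨_, rfl⟩
  have mem_A : ∀ v e f, f ∈ A v e ↔ f ∈ H ∧ v ∉ f ∧ ¬ Disjoint f e := fun v e f => by
    rw [hA]; exact Finset.mem_filter
  have Anb : ∀ v e, A v e ⊆ nb e := fun v e f hf => by
    rw [mem_A] at hf; rw [mem_nb]; exact ⟨hf.1, hf.2.2⟩
  have AH : ∀ v e, A v e ⊆ H := fun v e => (Anb v e).trans (nbH e)
  obtain ⟨μ, hμ⟩ : ∃ μ : ℕ → ℝ,
    μ = fun v => ∑ e ∈ H with v ∈ e, b e * ∏ f ∈ A v e, (1 - p f) := ⟨_, rfl⟩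
  have μ1 : ∀ v ∈ V, μ v ≤ 1 := fun v hv => by
    set q := ∏ f ∈ H with v ∈ f, (1 - p f) with hq
    have qlb : 1 - ε ≤ q := by
      have := one_sub_sum_le (H.filter (fun f => v ∈ f)) p
        (fun f hf => p0 f (Finset.mem_filter.1 hf).1) (fun f hf => p1 f (Finset.mem_filter.1 hf).1)
      have h2 := pdeg v hv
      unfold wdeg at h2
      linarith
    have hsplit : ∀ e ∈ H, v ∈ e → s e = (∏ f ∈ A v e, (1 - p f)) * q := fun e he hve => by
      rw [hs, hq]
      simp only
      rw [← Finset.prod_union]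
      · refine Finset.prod_congr ?_ fun _ _ => rfl
        ext f
        rw [Finset.mem_union, mem_nb, mem_A, Finset.mem_filter]
        have : v ∈ f → ¬ Disjoint f e := fun h => Finset.not_disjoint_iff.2 ⟨v, h, hve⟩
        tauto
      · rw [Finset.disjoint_left]
        intro f hf hf'
        exact ((mem_A _ _ _).1 hf).2.1 (Finset.mem_filter.1 hf').2
    have h1 : μ v * q = (1 - ε) * wdeg H w v := by
      rw [hμ]
      simp only
      rw [wdeg, Finset.sum_mul, Finset.mul_sum]
      refine Finset.sum_congr rfl fun e he => ?_
      rw [Finset.mem_filter] at he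
      rw [← bs e he.1, hsplit e he.1 he.2]
      ring
    have h2 := hdeg v hv
    by_contra! hcon
    nlinarith
  obtain ⟨Z, hZ⟩ : ∃ Z : ℕ → Finset (Finset ℕ) → ℝ,
    Z = fun v S => ∑ e ∈ H with v ∈ e, b e * (if Disjoint S (A v e) then 1 else 0) := ⟨_, rfl⟩
  have hvar : ∀ v ∈ V, ∑ S ∈ H.powerset, pr H p S * (Z v S - μ v) ^ 2 ≤ 4 * k ^ 2 * ε * δ :=
      fun v hv => by
    rw [hZ, hμ]
    refine (var_bound H p p0 p1 (H.filter (fun e => v ∈ e)) b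
      (fun e he => b0 e (Finset.mem_filter.1 he).1) (A v) (fun e _ => AH v e)).trans ?_
    have inner : ∀ e ∈ H, ∑ e' ∈ H with v ∈ e', w e' * ∑ f ∈ A v e ∩ A v e', p f
        ≤ k * δ * (k * ε) := fun e he => by
      have h1 : ∑ e' ∈ H with v ∈ e', w e' * ∑ f ∈ A v e ∩ A v e', p f
          = ∑ f ∈ A v e, p f * ∑ e' ∈ (H.filter (fun e' => v ∈ e')).filter
              (fun e' => f ∈ A v e'), w e' := by
        simp_rw [Finset.mul_sum]
        rw [Finset.sum_comm' (t' := A v e) (s' := fun f => (H.filter (fun e' => v ∈ e')).filter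
              (fun e' => f ∈ A v e'))]
        · exact Finset.sum_congr rfl fun f _ => Finset.sum_congr rfl fun e' _ => mul_comm _ _
        · intro e' f
          simp only [Finset.mem_inter, Finset.mem_filter]
          tauto
      rw [h1]
      have h2 : ∀ f ∈ A v e, ∑ e' ∈ (H.filter (fun e' => v ∈ e')).filter
              (fun e' => f ∈ A v e'), w e' ≤ k * δ := fun f hf => by
        have hf' := (mem_A _ _ _).1 hf
        refine (cover_bound (H.filter (fun e' => v ∈ e')) _ w (Finset.filter_subset _ _)
          (fun g hg => hw g (Finset.mem_filter.1 hg).1) f fun g hg => ?_).trans ?_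
        · have := ((mem_A _ _ _).1 (Finset.mem_filter.1 hg).2).2.2
          rw [Finset.not_disjoint_iff] at this
          exact this
        · calc _ ≤ ∑ u ∈ f, δ := Finset.sum_le_sum fun u hu => by
                have huv : v ≠ u := fun h => hf'.2.1 (h ▸ hu)
                have := hco v hv u (hV f hf'.1 hu) huv
                rw [wdeg, Finset.filter_filter]
                exact this
            _ = k * δ := by rw [Finset.sum_const, hcard f hf'.1, nsmul_eq_mul]
      calc _ ≤ ∑ f ∈ A v e, p f * (k * δ) := Finset.sum_le_sum fun f hf =>
              mul_le_mul_of_nonneg_left (h2 f hf) (p0 f (AH v e hf))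
        _ = k * δ * ∑ f ∈ A v e, p f := by rw [← Finset.sum_mul, mul_comm]
        _ ≤ _ := mul_le_mul_of_nonneg_left (nbsum e he _ (Anb v e)) (by positivity)
    have I0 : ∀ e e', 0 ≤ ∑ f ∈ A v e ∩ A v e', p f := fun e e' =>
      Finset.sum_nonneg fun f hf => p0 f (AH v e (Finset.mem_inter.1 hf).1)
    calc _ ≤ ∑ e ∈ H with v ∈ e, ∑ e' ∈ H with v ∈ e',
            (2 * w e) * (2 * w e') * ∑ f ∈ A v e ∩ A v e', p f := by
          refine Finset.sum_le_sum fun e he => Finset.sum_le_sum fun e' he' => ?_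
          rw [Finset.mem_filter] at he he'
          refine mul_le_mul_of_nonneg_right ?_ (I0 e e')
          exact mul_le_mul (b2 e he.1) (b2 e' he'.1) (b0 e' he'.1) (by linarith [hw e he.1])
      _ = ∑ e ∈ H with v ∈ e, w e * (4 * ∑ e' ∈ H with v ∈ e', w e' * ∑ f ∈ A v e ∩ A v e', p f) := by
          refine Finset.sum_congr rfl fun e _ => ?_
          rw [← mul_assoc, Finset.mul_sum]
          exact Finset.sum_congr rfl fun e' _ => by ring
      _ ≤ ∑ e ∈ H with v ∈ e, w e * (4 * (k * δ * (k * ε))) := by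
          refine Finset.sum_le_sum fun e he => ?_
          rw [Finset.mem_filter] at he
          exact mul_le_mul_of_nonneg_left (by linarith [inner e he.1]) (hw e he.1)
      _ = wdeg H w v * (4 * (k * δ * (k * ε))) := by rw [wdeg, Finset.sum_mul]
      _ ≤ 1 * (4 * (k * δ * (k * ε))) := mul_le_mul_of_nonneg_right (hdeg v hv) (by positivity)
      _ = _ := by ring
  -- the random variable to be maximized
  obtain ⟨X, hX⟩ : ∃ X : Finset (Finset ℕ) → ℝ, X = fun S =>
      (∑ e ∈ H, if e ∈ S ∧ Disjoint S ((nb e).erase e) then (1 : ℝ) else 0)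
      + c * (∑ e ∈ H, b e * (if Disjoint S (nb e) then 1 else 0)
        - ∑ v ∈ V, ((Z v S - μ v) ^ 2 / t + t)) := ⟨_, rfl⟩
  have hEX : (ε * (1 - k * ε) + c * (1 - ε)) * ∑ e ∈ H, w e
      - c * (4 * k ^ 2 * ε * δ / t + t) * V.card ≤ ∑ S ∈ H.powerset, pr H p S * X S := by
    have E1 : ε * (1 - k * ε) * ∑ e ∈ H, w e ≤ ∑ S ∈ H.powerset, pr H p S *
        (∑ e ∈ H, if e ∈ S ∧ Disjoint S ((nb e).erase e) then (1 : ℝ) else 0) := by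
      simp_rw [Finset.mul_sum (s := H)]
      rw [Finset.sum_comm]
      refine Finset.sum_le_sum fun e he => ?_
      rw [pr_sel H p ((nb e).erase e) ((Finset.erase_subset _ _).trans (nbH e)) e he
        (Finset.notMem_erase _ _)]
      have := mul_le_mul_of_nonneg_left (prodlb e he _ (Finset.erase_subset e (nb e))) (p0 e he)
      rw [hp] at this ⊢
      simp only at this ⊢
      linarith
    have E2 : ∑ S ∈ H.powerset, pr H p S * (∑ e ∈ H, b e * (if Disjoint S (nb e) then 1 else 0))
        = (1 - ε) * ∑ e ∈ H, w e := by
      simp_rw [Finset.mul_sum (s := H)]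
      rw [Finset.sum_comm]
      refine Finset.sum_congr rfl fun e he => ?_
      rw [← bs e he, hs]
      simp only
      rw [← pr_avoid H p (nb e) (nbH e), Finset.mul_sum]
      exact Finset.sum_congr rfl fun S _ => by ring
    have E3 : ∑ S ∈ H.powerset, pr H p S * (∑ v ∈ V, ((Z v S - μ v) ^ 2 / t + t))
        ≤ (4 * k ^ 2 * ε * δ / t + t) * V.card := by
      simp_rw [Finset.mul_sum (s := V)]
      rw [Finset.sum_comm]
      calc _ ≤ ∑ v ∈ V, (4 * k ^ 2 * ε * δ / t + t) := by
            refine Finset.sum_le_sum fun v hv => ?_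
            have : ∑ S ∈ H.powerset, pr H p S * ((Z v S - μ v) ^ 2 / t + t)
              = (∑ S ∈ H.powerset, pr H p S * (Z v S - μ v) ^ 2) / t + t := by
              have e1 : ∀ S ∈ H.powerset, pr H p S * ((Z v S - μ v) ^ 2 / t + t)
                = pr H p S * (Z v S - μ v) ^ 2 / t + pr H p S * t := fun S _ => by ring
              rw [Finset.sum_congr rfl e1, Finset.sum_add_distrib, ← Finset.sum_div,
                ← Finset.sum_mul, pr_total, one_mul]
            rw [this]
            have := div_le_div_of_nonneg_right (hvar v hv) ht.le
            linarith
        _ = _ := by rw [Finset.sum_const, nsmul_eq_mul, mul_comm]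
    have E4 : ∑ S ∈ H.powerset, pr H p S * X S = ∑ S ∈ H.powerset, pr H p S *
        (∑ e ∈ H, if e ∈ S ∧ Disjoint S ((nb e).erase e) then (1 : ℝ) else 0)
        + c * (∑ S ∈ H.powerset, pr H p S * (∑ e ∈ H, b e * (if Disjoint S (nb e) then 1 else 0))
          - ∑ S ∈ H.powerset, pr H p S * (∑ v ∈ V, ((Z v S - μ v) ^ 2 / t + t))) := by
      rw [← Finset.sum_sub_distrib, Finset.mul_sum, ← Finset.sum_add_distrib, hX]
      exact Finset.sum_congr rfl fun S _ => by ring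
    rw [E4, E2]
    have := mul_le_mul_of_nonneg_left E3 hc
    linarith
  obtain ⟨S, hSH, hSX⟩ := exists_ge H p p0 p1 X _ hEX
  set H' := H.filter (fun e => Disjoint S (nb e)) with hH'
  obtain ⟨w', hw', hw'd, hw's⟩ := truncate V H' (fun e he => hV e (Finset.mem_filter.1 he).1) b
    (fun e he => b0 e (Finset.mem_filter.1 he).1)
  refine ⟨H.filter (fun e => e ∈ S ∧ Disjoint S ((nb e).erase e)), Finset.filter_subset _ _, ?_,
    H', Finset.filter_subset _ _, ?_, w', ?_, hw'd, hSX.trans ?_⟩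
  · intro e he f hf hef
    rw [Finset.mem_filter] at he hf
    by_contra hd
    exact Finset.disjoint_left.1 hf.2.2 he.2.1
      (Finset.mem_erase.2 ⟨hef, (mem_nb _ _).2 ⟨he.1, hd⟩⟩)
  · intro e he f hf
    rw [Finset.mem_filter] at he
    rw [hH', Finset.mem_filter] at hf
    by_contra hd
    exact Finset.disjoint_left.1 hf.2 he.2.1 ((mem_nb _ _).2 ⟨he.1, hd⟩)
  · intro e he
    exact ⟨(hw' e he).1, (hw' e he).2.trans (b2 e (Finset.mem_filter.1 he).1)⟩
  · rw [hX]
    simp only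
    rw [Finset.sum_boole]
    have hs1 : ∑ e ∈ H, b e * (if Disjoint S (nb e) then (1 : ℝ) else 0) = ∑ e ∈ H', b e := by
      rw [hH', Finset.sum_filter]
      exact Finset.sum_congr rfl fun e _ => by split_ifs <;> simp
    have hs2 : ∑ v ∈ V, max 0 (wdeg H' b v - 1) ≤ ∑ v ∈ V, ((Z v S - μ v) ^ 2 / t + t) := by
      refine Finset.sum_le_sum fun v hv => ?_
      have hz : wdeg H' b v ≤ Z v S := by
        rw [hZ, wdeg, hH', Finset.filter_filter]
        simp only
        rw [Finset.sum_filter, Finset.sum_filter]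
        refine Finset.sum_le_sum fun e he => ?_
        by_cases hv' : v ∈ e
        · by_cases hd : Disjoint S (nb e)
          · have : Disjoint S (A v e) := Finset.disjoint_of_subset_right (Anb v e) hd
            simp [hv', hd, this]
          · simp only [hv', hd, false_and, if_false, if_true]
            exact mul_nonneg (b0 e he) (by split_ifs <;> norm_num)
        · simp [hv']
      refine max_le (by positivity) ?_
      have h3 : Z v S - μ v ≤ (Z v S - μ v) ^ 2 / t + t := by
        rw [← sub_le_iff_le_add, le_div_iff₀ ht]
        nlinarith [sq_nonneg (Z v S - μ v - t), sq_nonneg (Z v S - μ v), sq_nonneg t]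
      linarith [μ1 v hv]
    have : ∑ e ∈ H', b e - ∑ v ∈ V, ((Z v S - μ v) ^ 2 / t + t) ≤ ∑ e ∈ H', w' e := by linarith
    rw [hs1]
    have := mul_le_mul_of_nonneg_left this hc
    linarith

lemma main (k : ℕ) (hk : 1 ≤ k) (ε : ℝ) (hε : 0 < ε) (hkε : k * ε ≤ 1 / 2) (j : ℕ) :
    ∀ η : ℝ, 0 < η → ∃ δ : ℝ, 0 < δ ∧ ∀ (V : Finset ℕ) (H : Finset (Finset ℕ)),
      (∀ e ∈ H, e ⊆ V) → (∀ e ∈ H, e.card = k) → ∀ w : Finset ℕ → ℝ, (∀ e ∈ H, 0 ≤ w e) →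
      (∀ v ∈ V, wdeg H w v ≤ 1) →
      (∀ u ∈ V, ∀ v ∈ V, u ≠ v → ∑ e ∈ H with (u ∈ e ∧ v ∈ e), w e ≤ δ) →
      ∃ M ⊆ H, IsMatching M ∧
        (1 - k * ε) * (1 - (1 - ε) ^ j) * ∑ e ∈ H, w e - η * V.card ≤ M.card := by
  have hk1 : (1 : ℝ) ≤ k := by exact_mod_cast hk
  have hε2 : ε ≤ 1 / 2 := by nlinarith
  induction j with
  | zero =>
    intro η hη
    refine ⟨1, one_pos, fun V H _ _ w _ _ _ => ⟨∅, Finset.empty_subset _, ?_, ?_⟩⟩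
    · intro e he; simp at he
    · simp; positivity
  | succ j ih =>
    intro η hη
    obtain ⟨δ', hδ', ih⟩ := ih (η / 2) (by linarith)
    set c := (1 - k * ε) * (1 - (1 - ε) ^ j) with hc
    have pw0 : 0 ≤ (1 - ε) ^ j := pow_nonneg (by linarith) j
    have pw1 : (1 - ε) ^ j ≤ 1 := pow_le_one₀ (by linarith) (by linarith)
    have hc0 : 0 ≤ c := mul_nonneg (by linarith) (by linarith)
    have hkε0 : 0 ≤ k * ε := by positivity
    have hc1 : c ≤ 1 := mul_le_one₀ (by linarith) (by linarith) (by linarith)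
    set t := η / 4 with ht
    have ht0 : 0 < t := by rw [ht]; linarith
    set δ := min (δ' / 2) (t ^ 2 / (4 * k ^ 2 * ε)) with hδ
    have hkk : 0 < 4 * (k : ℝ) ^ 2 * ε := by positivity
    have hδ0 : 0 < δ := lt_min (by linarith) (by positivity)
    have herr : 4 * (k : ℝ) ^ 2 * ε * δ / t + t ≤ η / 2 := by
      have h1 : δ ≤ t ^ 2 / (4 * k ^ 2 * ε) := min_le_right _ _
      rw [le_div_iff₀ hkk] at h1
      have : 4 * (k : ℝ) ^ 2 * ε * δ / t ≤ t := by
        rw [div_le_iff₀ ht0]; linarith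
      linarith
    refine ⟨δ, hδ0, fun V H hV hcard w hw hdeg hco => ?_⟩
    obtain ⟨M, hMH, hM, H', hH', hdis, w', hw', hdeg', hsum⟩ :=
      step k hk ε hε hkε c hc0 t ht0 δ hδ0.le V H hV hcard w hw hdeg hco
    obtain ⟨M', hM'H, hM', hsum'⟩ := ih V H' (fun e he => hV e (hH' he))
      (fun e he => hcard e (hH' he)) w' (fun e he => (hw' e he).1) hdeg' (by
        intro u hu v hv huv
        calc ∑ e ∈ H' with (u ∈ e ∧ v ∈ e), w' e
            ≤ ∑ e ∈ H' with (u ∈ e ∧ v ∈ e), 2 * w e :=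
              Finset.sum_le_sum fun e he => (hw' e (Finset.mem_filter.1 he).1).2
          _ ≤ ∑ e ∈ H with (u ∈ e ∧ v ∈ e), 2 * w e :=
              Finset.sum_le_sum_of_subset_of_nonneg (Finset.filter_subset_filter _ hH')
                (fun e he _ => by linarith [hw e (Finset.mem_filter.1 he).1])
          _ = 2 * ∑ e ∈ H with (u ∈ e ∧ v ∈ e), w e := by rw [Finset.mul_sum]
          _ ≤ δ' := by linarith [hco u hu v hv huv, min_le_left (δ' / 2) (t ^ 2 / (4 * k ^ 2 * ε))])
    have hdisj : Disjoint M M' := by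
      rw [Finset.disjoint_left]
      intro e he he'
      have h := hdis e he e (hM'H he')
      rw [disjoint_self] at h
      have := hcard e (hMH he)
      rw [h] at this
      simp at this
      omega
    refine ⟨M ∪ M', Finset.union_subset hMH (hM'H.trans hH'), ?_, ?_⟩
    · intro e he f hf hef
      rcases Finset.mem_union.1 he with he | he <;> rcases Finset.mem_union.1 hf with hf | hf
      · exact hM e he f hf hef
      · exact hdis e he f (hM'H hf)
      · exact (hdis f hf e (hM'H he)).symm
      · exact hM' e he f hf hef
    · rw [Finset.card_union_of_disjoint hdisj]
      push_cast
      have hcc : (1 - k * ε) * (1 - (1 - ε) ^ (j + 1)) = ε * (1 - k * ε) + c * (1 - ε) := by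
        rw [hc]; ring
      rw [hcc]
      have hn : (0 : ℝ) ≤ V.card := by positivity
      have e1 : c * (4 * k ^ 2 * ε * δ / t + t) * V.card ≤ η / 2 * V.card := by
        refine mul_le_mul_of_nonneg_right ?_ hn
        have : 0 ≤ 4 * (k : ℝ) ^ 2 * ε * δ / t + t := by positivity
        nlinarith
      linarith

end FR

/-- the Frankl–Rödl theorem on almost perfect matchings in
almost regular hypergraphs with small codegrees. -/
theorem frankl_rodl (k : ℕ) (hk : k ≥ 2) (σ : ℝ) (hσ : 0 < σ) :
    ∃ τ : ℝ, 0 < τ ∧ ∃ d₀ : ℕ, ∀ n D : ℕ, n ≥ D → D ≥ d₀ →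
      ∀ H : Finset (Finset ℕ), IsKGraphOn n k H →
        (∀ v ∈ Finset.Icc 1 n,
          (1 - τ) * (D : ℝ) < (degOf H v : ℝ) ∧ (degOf H v : ℝ) < (1 + τ) * (D : ℝ)) →
        (∀ u ∈ Finset.Icc 1 n, ∀ v ∈ Finset.Icc 1 n, u ≠ v →
          (((H.filter (fun e => u ∈ e ∧ v ∈ e)).card : ℝ)) < τ * (D : ℝ)) →
        ∃ M ⊆ H, IsMatching M ∧ ((n : ℝ) - ((M.biUnion id).card : ℝ)) ≤ σ * n := by
  have hk1 : 1 ≤ k := by omega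
  have hkR : (1 : ℝ) ≤ k := by exact_mod_cast hk1
  have hkpos : (0 : ℝ) < k := by linarith
  set ε : ℝ := min (1 / (2 * k)) (σ / (4 * k)) with hεdef
  have hε : 0 < ε := lt_min (by positivity) (by positivity)
  have hkε : k * ε ≤ 1 / 2 := by
    have h : ε ≤ 1 / (2 * k) := min_le_left _ _
    rw [le_div_iff₀ (by positivity)] at h
    linarith
  have hkεσ : k * ε ≤ σ / 4 := by
    have h : ε ≤ σ / (4 * k) := min_le_right _ _
    rw [le_div_iff₀ (by positivity)] at h
    linarith
  have hε2 : ε ≤ 1 / 2 := by nlinarith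
  obtain ⟨j, hj⟩ := exists_pow_lt_of_lt_one (show (0 : ℝ) < σ / 4 by linarith)
    (show 1 - ε < 1 by linarith)
  obtain ⟨δ, hδ, hmain⟩ := FR.main k hk1 ε hε hkε j (σ / (4 * k)) (by positivity)
  set τ : ℝ := min (min (1 / 2) (σ / 8)) δ with hτdef
  have hτ : 0 < τ := lt_min (lt_min (by norm_num) (by linarith)) hδ
  have hτ1 : τ ≤ 1 / 2 := (min_le_left _ _).trans (min_le_left _ _)
  have hτ2 : τ ≤ σ / 8 := (min_le_left _ _).trans (min_le_right _ _)
  have hτ3 : τ ≤ δ := min_le_right _ _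
  refine ⟨τ, hτ, 1, fun n D _ hD H hH hdeg hco => ?_⟩
  have hDR : (1 : ℝ) ≤ D := by exact_mod_cast hD
  set x : ℝ := 1 / ((1 + τ) * D) with hx
  have hpos : 0 < (1 + τ) * (D : ℝ) := by positivity
  have hx0 : 0 < x := by positivity
  have hwd : ∀ v, FR.wdeg H (fun _ => x) v = degOf H v * x := fun v => by
    rw [FR.wdeg, Finset.sum_const, nsmul_eq_mul, degOf]
  have hxD : (1 + τ) * (D : ℝ) * x = 1 := by rw [hx]; field_simp
  obtain ⟨M, hMH, hM, hcardM⟩ := hmain (Finset.Icc 1 n) H (fun e he => (hH e he).1)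
    (fun e he => (hH e he).2) (fun _ => x) (fun _ _ => hx0.le)
    (fun v hv => by
      rw [hwd]
      have := mul_le_mul_of_nonneg_right (hdeg v hv).2.le hx0.le
      linarith)
    (fun u hu v hv huv => by
      rw [Finset.sum_const, nsmul_eq_mul]
      have h1 := mul_le_mul_of_nonneg_right (hco u hu v hv huv).le hx0.le
      have h2 : τ * D * x ≤ τ := by
        have : (D : ℝ) * x ≤ 1 := by nlinarith [mul_pos (mul_pos hτ (by linarith : (0 : ℝ) < D)) hx0]
        nlinarith
      linarith)
  refine ⟨M, hMH, hM, ?_⟩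
  have hcov : ((M.biUnion id).card : ℝ) = M.card * k := by
    rw [Finset.card_biUnion (t := id) (fun e he f hf hef => hM e he f hf hef)]
    rw [Finset.sum_congr rfl (fun e he => show (id e).card = k from (hH e (hMH he)).2)]
    rw [Finset.sum_const]
    simp
  have hW : (1 - 2 * τ) * n ≤ k * ∑ e ∈ H, x := by
    have h1 := FR.sum_edges_comm (Finset.Icc 1 n) H (fun e he => (hH e he).1) (fun _ => x) (fun _ => 1)
    have h2 : ∑ e ∈ H, x * ∑ v ∈ e, (1 : ℝ) = k * ∑ e ∈ H, x := by
      rw [Finset.mul_sum]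
      refine Finset.sum_congr rfl fun e he => ?_
      rw [Finset.sum_const, (hH e he).2, nsmul_eq_mul, mul_one, mul_comm]
    rw [← h2, h1]
    calc (1 - 2 * τ) * n = ∑ v ∈ Finset.Icc 1 n, (1 - 2 * τ) := by
          rw [Finset.sum_const, nsmul_eq_mul, Nat.card_Icc]; simp; ring
      _ ≤ _ := Finset.sum_le_sum fun v hv => by
          rw [mul_one, hwd]
          have h3 := mul_le_mul_of_nonneg_right (hdeg v hv).1.le hx0.le
          have h4 : 1 - 2 * τ ≤ (1 - τ) * D * x := by
            have e1 : (D : ℝ) * x = 1 / (1 + τ) := by rw [hx]; field_simp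
            rw [mul_assoc, e1, mul_one_div, le_div_iff₀ (by linarith)]
            nlinarith
          linarith
  set W := ∑ e ∈ H, x
  rw [Nat.card_Icc, Nat.add_sub_cancel] at hcardM
  set P := (1 - ε) ^ j
  have hP0 : 0 ≤ P := pow_nonneg (by linarith) j
  have hP1 : P ≤ 1 := pow_le_one₀ (by linarith) (by linarith)
  have hkε0 : 0 ≤ k * ε := by positivity
  set c := (1 - k * ε) * (1 - P) with hc
  have hc0 : 0 ≤ c := mul_nonneg (by linarith) (by linarith)
  have hc1 : c ≤ 1 := mul_le_one₀ (by linarith) (by linarith) (by linarith)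
  have hclb : 1 - σ / 2 ≤ c := by rw [hc]; nlinarith [mul_nonneg hkε0 hP0]
  have hn : (0 : ℝ) ≤ n := by positivity
  have a1 := mul_le_mul_of_nonneg_left hcardM hkpos.le
  have a2 : k * (c * W - σ / (4 * k) * n) = c * (k * W) - σ / 4 * n := by field_simp
  rw [a2] at a1
  have a3 := mul_le_mul_of_nonneg_left hW hc0
  have a4 : 1 - σ / 2 - σ / 4 ≤ c * (1 - 2 * τ) := by nlinarith
  have a5 := mul_le_mul_of_nonneg_right a4 hn
  rw [hcov]
  linarith
end

section
/- There exists c₀ > 0 such that for every real c with 0 < c < c₀ there exists ε₀ > 0 such that for every real ε with 0 < ε < ε₀ there exists n₀ such that the following holds for all integers n ≥ n₀ and m with n/27 ≤ m ≤ (1−c)n/3: if F = {F_1, ..., F_m} is a stable family of 3-graphs on vertex set [n] with |F_i| > f(n,m,3) for every i ∈ [m], and H(F) is ε-close to H_D(n,m,3), then F admits a rainbow matching. -/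
open Finset

lemma sort_three {a b c : ℕ} (hab : a < b) (hbc : b < c) :
    ({a, b, c} : Finset ℕ).sort (· ≤ ·) = [a, b, c] := by
  have h : ({a, b, c} : Finset ℕ) = [a, b, c].toFinset := by simp
  rw [h]
  apply List.toFinset_sort (r := (· ≤ ·)) _ |>.mpr
  · simp; omega
  · simp; omega

lemma card_three_sorted {e : Finset ℕ} (h : e.card = 3) :
    ∃ x y z, x < y ∧ y < z ∧ e = {x, y, z} := by
  obtain ⟨x, y, z, hxy, hxz, hyz, rfl⟩ := Finset.card_eq_three.mp h
  rcases lt_or_gt_of_ne hxy with h1 | h1 <;> rcases lt_or_gt_of_ne hxz with h2 | h2 <;>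
    rcases lt_or_gt_of_ne hyz with h3 | h3
  · exact ⟨x, y, z, h1, h3, rfl⟩
  · exact ⟨x, z, y, h2, h3, by ext w; simp; tauto⟩
  · omega
  · exact ⟨z, x, y, h2, h1, by ext w; simp; tauto⟩
  · exact ⟨y, x, z, h1, h2, by ext w; simp; tauto⟩
  · omega
  · exact ⟨y, z, x, h3, h2, by ext w; simp; tauto⟩
  · exact ⟨z, y, x, h3, h1, by ext w; simp; tauto⟩

lemma domLE_three {a b c x y z : ℕ} (hab : a < b) (hbc : b < c) (hxy : x < y) (hyz : y < z)
    (h1 : a ≤ x) (h2 : b ≤ y) (h3 : c ≤ z) : DomLE {a, b, c} {x, y, z} := by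
  unfold DomLE
  rw [sort_three hab hbc, sort_three hxy hyz]
  simp [h1, h2, h3]

/-- Stability for explicit triples. -/
lemma stable_three {n : ℕ} {F : Finset (Finset ℕ)} (hS : StableGraph n F)
    {a b c x y z : ℕ} (ha : 1 ≤ a) (hc : c ≤ n) (hab : a < b) (hbc : b < c)
    (hxy : x < y) (hyz : y < z)
    (h1 : a ≤ x) (h2 : b ≤ y) (h3 : c ≤ z) (hf : ({x, y, z} : Finset ℕ) ∈ F) :
    ({a, b, c} : Finset ℕ) ∈ F := by
  refine hS _ _ ?_ (domLE_three hab hbc hxy hyz h1 h2 h3) hf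
  intro w hw
  simp at hw ⊢
  omega

/-- If `{p,2p,v}` is missing then every edge not inside `[v-1]` meets `[2p]`. -/
lemma small_of_missing {n p v : ℕ} {F : Finset (Finset ℕ)} (hK : IsKGraphOn n 3 F)
    (hS : StableGraph n F) (hp : 1 ≤ p) (hv : 2 * p < v) (hvn : v ≤ n)
    (hmiss : ({p, 2 * p, v} : Finset ℕ) ∉ F) {e : Finset ℕ} (he : e ∈ F)
    {w : ℕ} (hw : w ∈ e) (hvw : v ≤ w) : ∃ x ∈ e, x ∈ Finset.Icc 1 (2 * p) ∧ x ≠ w := by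
  obtain ⟨hsub, hcard⟩ := hK e he
  obtain ⟨x, y, z, hxy, hyz, rfl⟩ := card_three_sorted hcard
  by_contra hcon
  push Not at hcon
  apply hmiss
  have hx1 : 1 ≤ x := (Finset.mem_Icc.mp (hsub (by simp : x ∈ ({x, y, z} : Finset ℕ)))).1
  have hxx : ¬ x ≤ 2 * p := by
    intro h
    have := hcon x (by simp) (by simp; omega)
    omega
  have hwz : w ≤ z := by simp at hw; omega
  exact stable_three hS hp hvn (by omega) hv hxy hyz (by omega) (by omega) (by omega) he

/-- Number of pairs in `[n]` meeting `[q]`. -/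
lemma card_pairs_meet (n q : ℕ) :
    (((Finset.Icc 1 n).powersetCard 2).filter (fun e => ∃ x ∈ e, x ∈ Finset.Icc 1 q)).card
      ≤ q * n := by
  have : (((Finset.Icc 1 n).powersetCard 2).filter (fun e => ∃ x ∈ e, x ∈ Finset.Icc 1 q)) ⊆
      (Finset.Icc 1 q ×ˢ Finset.Icc 1 n).image (fun xy => ({xy.1, xy.2} : Finset ℕ)) := by
    intro e he
    simp only [Finset.mem_filter, Finset.mem_powersetCard] at he
    obtain ⟨⟨hsub, hcard⟩, x, hx, hxq⟩ := he
    obtain ⟨u, w, huw, rfl⟩ := Finset.card_eq_two.mp hcard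
    simp only [Finset.mem_image, Finset.mem_product]
    have hu := hsub (by simp : u ∈ ({u, w} : Finset ℕ))
    have hw := hsub (by simp : w ∈ ({u, w} : Finset ℕ))
    simp at hx
    rcases hx with rfl | rfl
    · exact ⟨(x, w), ⟨hxq, hw⟩, rfl⟩
    · exact ⟨(x, u), ⟨hxq, hu⟩, by simp [Finset.pair_comm]⟩
  refine (Finset.card_le_card this).trans (Finset.card_image_le.trans ?_)
  simp

/-- Edges through `v`, via their links. -/
lemma card_link_le {v : ℕ} {G P : Finset (Finset ℕ)} (hG : ∀ e ∈ G, v ∈ e ∧ e.erase v ∈ P) :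
    G.card ≤ P.card := by
  refine Finset.card_le_card_of_injOn (fun e => e.erase v) (fun e he => (hG e he).2) ?_
  intro e he f hf hef
  rw [← Finset.insert_erase (hG e he).1, ← Finset.insert_erase (hG f hf).1]
  simp only at hef
  rw [hef]

/-- A vertex `w ≥ v` has small degree when `{p,2p,v}` is missing. -/
lemma deg_small {n p v : ℕ} {F : Finset (Finset ℕ)} (hK : IsKGraphOn n 3 F)
    (hS : StableGraph n F) (hp : 1 ≤ p) (hv : 2 * p < v) (hvn : v ≤ n)
    (hmiss : ({p, 2 * p, v} : Finset ℕ) ∉ F) {w : ℕ} (hvw : v ≤ w) :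
    (F.filter (fun e => w ∈ e)).card ≤ 2 * p * n := by
  refine le_trans ?_ (card_pairs_meet n (2 * p))
  refine card_link_le (v := w) ?_
  intro e he
  obtain ⟨heF, hwe⟩ := Finset.mem_filter.mp he
  refine ⟨hwe, ?_⟩
  obtain ⟨x, hx, hx2, hxw⟩ := small_of_missing hK hS hp hv hvn hmiss heF hwe hvw
  obtain ⟨hsub, hcard⟩ := hK e heF
  simp only [Finset.mem_filter, Finset.mem_powersetCard]
  refine ⟨⟨(Finset.erase_subset _ _).trans hsub, by rw [Finset.card_erase_of_mem hwe, hcard]⟩,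
    x, Finset.mem_erase.mpr ⟨hxw, hx⟩, hx2⟩

/-- Edges through `u ≤ t` which leave `[t]`. -/
lemma deg_leave {n t u : ℕ} {F : Finset (Finset ℕ)} (hK : IsKGraphOn n 3 F)
    (htn : t ≤ n) (hut : u ≤ t) :
    (F.filter (fun e => u ∈ e ∧ ¬ e ⊆ Finset.Icc 1 t)).card ≤ n.choose 2 - t.choose 2 := by
  have h1 : ((Finset.Icc 1 n).powersetCard 2 \ (Finset.Icc 1 t).powersetCard 2).card
      = n.choose 2 - t.choose 2 := by
    rw [Finset.card_sdiff_of_subset]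
    · simp
    · exact Finset.powersetCard_mono (Finset.Icc_subset_Icc_right htn)
  rw [← h1]
  refine card_link_le (v := u) ?_
  intro e he
  obtain ⟨heF, hue, hnot⟩ := Finset.mem_filter.mp he
  obtain ⟨hsub, hcard⟩ := hK e heF
  refine ⟨hue, ?_⟩
  simp only [Finset.mem_sdiff, Finset.mem_powersetCard]
  refine ⟨⟨(Finset.erase_subset _ _).trans hsub, by rw [Finset.card_erase_of_mem hue, hcard]⟩, ?_⟩
  rintro ⟨h, -⟩
  apply hnot
  intro x hx
  by_cases hxu : x = u
  · have := Finset.mem_Icc.mp (hsub hx)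
    subst hxu
    exact Finset.mem_Icc.mpr ⟨this.1, hut⟩
  · exact h (Finset.mem_erase.mpr ⟨hxu, hx⟩)

/-- Global bound when `{p,2p,v}` is missing. -/
lemma card_le_of_missing {n p v : ℕ} {F : Finset (Finset ℕ)} (hK : IsKGraphOn n 3 F)
    (hS : StableGraph n F) (hp : 1 ≤ p) (hv : 2 * p < v) (hvn : v ≤ n)
    (hmiss : ({p, 2 * p, v} : Finset ℕ) ∉ F) :
    F.card ≤ (v - 1).choose 3 + 2 * p * n.choose 2 := by
  have hsub : F ⊆ (Finset.Icc 1 (v - 1)).powersetCard 3 ∪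
      (Finset.Icc 1 (2 * p)).biUnion (fun x => F.filter (fun e => x ∈ e)) := by
    intro e he
    by_cases h : e ⊆ Finset.Icc 1 (v - 1)
    · exact Finset.mem_union_left _ (Finset.mem_powersetCard.mpr ⟨h, (hK e he).2⟩)
    · apply Finset.mem_union_right
      obtain ⟨w, hw, hw2⟩ := Finset.not_subset.mp h
      have hw1 := Finset.mem_Icc.mp ((hK e he).1 hw)
      have : v ≤ w := by simp at hw2; omega
      obtain ⟨x, hx, hx2, -⟩ := small_of_missing hK hS hp hv hvn hmiss he hw this
      exact Finset.mem_biUnion.mpr ⟨x, hx2, Finset.mem_filter.mpr ⟨he, hx⟩⟩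
  refine (Finset.card_le_card hsub).trans ((Finset.card_union_le _ _).trans ?_)
  have h2 : ((Finset.Icc 1 (2 * p)).biUnion (fun x => F.filter (fun e => x ∈ e))).card
      ≤ (Finset.Icc 1 (2 * p)).card * n.choose 2 := by
    apply Finset.card_biUnion_le_card_mul
    intro x _
    have : n.choose 2 = ((Finset.Icc 1 n).powersetCard 2).card := by simp
    rw [this]
    refine card_link_le (v := x) ?_
    intro e he
    obtain ⟨heF, hue⟩ := Finset.mem_filter.mp he
    obtain ⟨hsub, hcard⟩ := hK e heF
    exact ⟨hue, Finset.mem_powersetCard.mpr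
      ⟨(Finset.erase_subset _ _).trans hsub, by rw [Finset.card_erase_of_mem hue, hcard]⟩⟩
  simp at h2 ⊢
  omega

/-- A partial rainbow matching with index set `I` and vertex set `U`. -/
def Ach {m : ℕ} (F : Fin m → Finset (Finset ℕ)) (I : Finset (Fin m)) (U : Finset ℕ) : Prop :=
  ∃ e : Fin m → Finset ℕ, (∀ i ∈ I, e i ∈ F i) ∧
    (∀ i ∈ I, ∀ j ∈ I, i ≠ j → Disjoint (e i) (e j)) ∧ I.biUnion e = U

lemma Ach.empty {m : ℕ} (F : Fin m → Finset (Finset ℕ)) : Ach F ∅ ∅ :=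
  ⟨fun _ => ∅, by simp, by simp, by simp⟩

lemma Ach.extend {m : ℕ} {F : Fin m → Finset (Finset ℕ)} {I : Finset (Fin m)} {U : Finset ℕ}
    (h : Ach F I U) {i : Fin m} (hi : i ∉ I) {f : Finset ℕ} (hf : f ∈ F i) (hd : Disjoint f U) :
    Ach F (insert i I) (f ∪ U) := by
  obtain ⟨e, h1, h2, h3⟩ := h
  have hne : ∀ j ∈ I, j ≠ i := fun j hj h => hi (h ▸ hj)
  have hdj : ∀ j ∈ I, Disjoint f (e j) := by
    intro j hj
    refine hd.mono_right ?_
    rw [← h3]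
    exact Finset.subset_biUnion_of_mem e hj
  refine ⟨Function.update e i f, ?_, ?_, ?_⟩
  · intro j hj
    rcases Finset.mem_insert.mp hj with rfl | hj
    · simpa using hf
    · rw [Function.update_of_ne (hne j hj)]; exact h1 j hj
  · intro j hj k hk hjk
    rcases Finset.mem_insert.mp hj with hj' | hj' <;>
      rcases Finset.mem_insert.mp hk with hk' | hk'
    · exact absurd (hj'.trans hk'.symm) hjk
    · rw [hj', Function.update_self, Function.update_of_ne (hne k hk')]; exact hdj k hk'
    · rw [hk', Function.update_self, Function.update_of_ne (hne j hj')]; exact (hdj j hj').symm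
    · replace hj := hj'
      replace hk := hk'
      rw [Function.update_of_ne (hne j hj), Function.update_of_ne (hne k hk)]
      exact h2 j hj k hk hjk
  · rw [Finset.biUnion_insert, Function.update_self, ← h3]
    congr 1
    apply Finset.biUnion_congr rfl
    intro j hj
    rw [Function.update_of_ne (hne j hj)]

lemma Ach.card {m n : ℕ} {F : Fin m → Finset (Finset ℕ)} (hK : ∀ i, IsKGraphOn n 3 (F i))
    {I : Finset (Fin m)} {U : Finset ℕ} (h : Ach F I U) : U.card = 3 * I.card := by
  obtain ⟨e, h1, h2, rfl⟩ := h
  rw [Finset.card_biUnion h2, Finset.sum_congr rfl (fun i hi => (hK i _ (h1 i hi)).2)]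
  simp [mul_comm]

/-- Final stage. -/
lemma Ach.finish {m q : ℕ} {F : Fin m → Finset (Finset ℕ)} (d : ℕ)
    (I : Finset (Fin m)) (U : Finset ℕ) (h : Ach F I U) (hd : m - I.card = d)
    (hgood : ∀ i, i ∉ I → (Finset.Icc 1 q).powersetCard 3 ⊆ F i)
    (hcard : 3 * (m - I.card) ≤ (Finset.Icc 1 q \ U).card) : HasRainbowMatching F := by
  induction d generalizing I U with
  | zero =>
    have hle : I.card ≤ m := by simpa using I.card_le_univ
    have : I = Finset.univ := by
      apply Finset.eq_univ_of_card
      simp; omega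
    subst this
    obtain ⟨e, h1, h2, -⟩ := h
    exact ⟨e, fun i => h1 i (by simp), fun i j => h2 i (by simp) j (by simp)⟩
  | succ d ih =>
    have : ∃ i, i ∉ I := by
      by_contra hcon
      push Not at hcon
      have : I = Finset.univ := by ext; simp [hcon]
      subst this
      simp at hd
    obtain ⟨i, hi⟩ := this
    obtain ⟨f, hfsub, hfcard⟩ := Finset.exists_subset_card_eq
      (show 3 ≤ (Finset.Icc 1 q \ U).card by omega)
    have hfF : f ∈ F i := hgood i hi (Finset.mem_powersetCard.mpr
      ⟨hfsub.trans Finset.sdiff_subset, hfcard⟩)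
    have hdis : Disjoint f U := Finset.disjoint_of_subset_left hfsub Finset.sdiff_disjoint
    refine ih _ _ (h.extend hi hfF hdis) ?_ ?_ ?_
    · rw [Finset.card_insert_of_notMem hi]; omega
    · intro j hj
      exact hgood j (fun h => hj (Finset.mem_insert_of_mem h))
    · rw [Finset.card_insert_of_notMem hi]
      have : Finset.Icc 1 q \ (f ∪ U) = (Finset.Icc 1 q \ U) \ f := by
        ext x; simp; tauto
      rw [this, Finset.card_sdiff_of_subset hfsub]
      omega

/-- Greedy extension through a big vertex. -/
lemma Ach.greedy {m n p v : ℕ} {F : Fin m → Finset (Finset ℕ)}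
    (hK : ∀ i, IsKGraphOn n 3 (F i)) (hS : ∀ i, StableGraph n (F i))
    {I : Finset (Fin m)} {U : Finset ℕ} (h : Ach F I U) {i : Fin m} (hi : i ∉ I)
    (hv : 2 * p < v) (hvn : v ≤ n) (hvU : v ∉ U) (hF : ({p, 2 * p, v} : Finset ℕ) ∈ F i)
    (hp : 3 * I.card < p) :
    ∃ U', Ach F (insert i I) U' ∧ insert v U ⊆ U' := by
  have hU := h.card hK
  have : ∃ j ∈ Finset.Icc 1 p, j ∉ U ∧ p + j ∉ U := by
    by_contra hcon
    push Not at hcon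
    have hle : (Finset.Icc 1 p).card ≤ U.card := by
      refine Finset.card_le_card_of_injOn (fun j => if j ∈ U then j else p + j) ?_ ?_
      · intro j hj
        by_cases hjU : j ∈ U
        · simp [hjU]
        · simp [hjU]; exact hcon j hj hjU
      · intro j hj k hk hjk
        simp at hj hk hjk
        split_ifs at hjk <;> omega
    simp at hle
    omega
  obtain ⟨j, hj, hj1, hj2⟩ := this
  rw [Finset.mem_Icc] at hj
  have hf : ({j, p + j, v} : Finset ℕ) ∈ F i :=
    stable_three (hS i) hj.1 hvn (by omega) (by omega) (by omega) hv (by omega) (by omega) le_rfl hF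
  refine ⟨_, h.extend hi hf ?_, ?_⟩
  · simp [hj1, hj2, hvU]
  · intro x hx
    simp at hx ⊢
    tauto

lemma good_of_few {n m a : ℕ} {F : Finset (Finset ℕ)}
    (hS : StableGraph n F) (ha : 1 ≤ a) (ham : a < 3 * m) (hmn : 3 * m ≤ n)
    (hfew : (DGraph n m 3 \ F).card < a.choose 3) :
    (Finset.Icc 1 (3 * m - a)).powersetCard 3 ⊆ F := by
  intro e he
  by_contra heF
  obtain ⟨hsub, hcard⟩ := Finset.mem_powersetCard.mp he
  have hle : ((Finset.Icc (3 * m - a) (3 * m - 1)).powersetCard 3).card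
      ≤ (DGraph n m 3 \ F).card := by
    apply Finset.card_le_card
    intro f hf
    obtain ⟨hfsub, hfcard⟩ := Finset.mem_powersetCard.mp hf
    rw [Finset.mem_sdiff]
    constructor
    · refine Finset.mem_powersetCard.mpr ⟨hfsub.trans ?_, hfcard⟩
      exact Finset.Icc_subset_Icc_left (by omega)
    · intro hfF
      apply heF
      obtain ⟨x, y, z, hxy, hyz, rfl⟩ := card_three_sorted hcard
      obtain ⟨u, v, w, huv, hvw, rfl⟩ := card_three_sorted hfcard
      have hx := Finset.mem_Icc.mp (hsub (by simp : x ∈ ({x, y, z} : Finset ℕ)))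
      have hz := Finset.mem_Icc.mp (hsub (by simp : z ∈ ({x, y, z} : Finset ℕ)))
      have hu := Finset.mem_Icc.mp (hfsub (by simp : u ∈ ({u, v, w} : Finset ℕ)))
      exact stable_three hS hx.1 (by omega) hxy hyz huv hvw (by omega) (by omega) (by omega) hfF
  rw [Finset.card_powersetCard, Nat.card_Icc,
    show 3 * m - 1 + 1 - (3 * m - a) = a by omega] at hle
  omega

lemma bad_count {n m C : ℕ} {F : Fin m → Finset (Finset ℕ)}
    (hK : ∀ i, IsKGraphOn n 3 (F i)) (hmn : 3 * m ≤ n) (B : Finset (Fin m))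
    (hB : ∀ i ∈ B, C ≤ (DGraph n m 3 \ F i).card) :
    B.card * C ≤ (HD n m 3 \ HF n F).card := by
  have h1 : B.card * C ≤ (B.sigma (fun i => DGraph n m 3 \ F i)).card := by
    rw [Finset.card_sigma, ← smul_eq_mul]
    exact Finset.card_nsmul_le_sum _ _ _ hB
  refine h1.trans ?_
  have hD : ∀ e ∈ DGraph n m 3, ∀ j : ℕ, n + j + 1 ∉ e := by
    intro e he j hj
    have := Finset.mem_Icc.mp ((Finset.mem_powersetCard.mp he).1 hj)
    omega
  have hF : ∀ i, ∀ e ∈ F i, ∀ j : ℕ, n + j + 1 ∉ e := by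
    intro i e he j hj
    have := Finset.mem_Icc.mp ((hK i e he).1 hj)
    omega
  have key : ∀ (i j : Fin m) (e f : Finset ℕ), (∀ j : ℕ, n + j + 1 ∉ e) →
      (∀ j : ℕ, n + j + 1 ∉ f) → insert (n + i.1 + 1) e = insert (n + j.1 + 1) f →
      i = j ∧ e = f := by
    intro i j e f he hf heq
    have hij : i = j := by
      have : n + i.1 + 1 ∈ insert (n + j.1 + 1) f := by rw [← heq]; simp
      rcases Finset.mem_insert.mp this with h | h
      · apply Fin.ext; omega
      · exact absurd h (hf _)
    subst hij
    refine ⟨rfl, ?_⟩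
    rw [← Finset.erase_insert (he i.1), heq, Finset.erase_insert (hf i.1)]
  refine Finset.card_le_card_of_injOn (fun x => insert (n + x.1.1 + 1) x.2) ?_ ?_
  · rintro ⟨i, e⟩ hx
    simp only [Finset.coe_sigma, Set.mem_sigma_iff, Finset.mem_coe, Finset.mem_sdiff] at hx
    obtain ⟨hi, heD, heF⟩ := hx
    simp only [Finset.mem_coe, Finset.mem_sdiff]
    constructor
    · exact Finset.mem_biUnion.mpr ⟨i, by simp, Finset.mem_image.mpr ⟨e, heD, rfl⟩⟩
    · intro hmem
      obtain ⟨j, -, hj⟩ := Finset.mem_biUnion.mp hmem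
      obtain ⟨f, hf, hfe⟩ := Finset.mem_image.mp hj
      obtain ⟨rfl, rfl⟩ := key _ _ _ _ (hF j f hf) (hD e heD) hfe
      exact heF hf
  · rintro ⟨i, e⟩ hx ⟨j, f⟩ hy heq
    simp only [Finset.coe_sigma, Set.mem_sigma_iff, Finset.mem_coe, Finset.mem_sdiff] at hx hy
    obtain ⟨rfl, rfl⟩ := key _ _ _ _ (hD e hx.2.1) (hD f hy.2.1) heq
    rfl

lemma choose_gap (t s : ℕ) : t.choose 3 + s * t.choose 2 ≤ (t + s).choose 3 := by
  induction s with
  | zero => simp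
  | succ s ih =>
    have h1 : (t + (s + 1)).choose 3 = (t + s).choose 2 + (t + s).choose 3 := by
      rw [← add_assoc]; exact Nat.choose_succ_succ _ _
    have h2 : t.choose 2 ≤ (t + s).choose 2 := Nat.choose_le_choose 2 (by omega)
    rw [h1]
    nlinarith

/-- First stage: find `3m - t` disjoint rainbow edges leaving `[t]`. -/
lemma first_stage {n m a p t : ℕ} {F : Fin m → Finset (Finset ℕ)}
    (hK : ∀ i, IsKGraphOn n 3 (F i)) (hS : ∀ i, StableGraph n (F i))
    (hp : 1 ≤ p) (hpt : 2 * p ≤ t) (htm : t < 3 * m) (hta : 3 * m ≤ t + a) (hmn : 3 * m ≤ n)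
    (hma : 3 * a ≤ m)
    (hcard : ∀ i, (3 * m - 1).choose 3 < (F i).card)
    (hfew : (Finset.univ.filter (fun i => ({p, 2 * p, t + 1} : Finset ℕ) ∈ F i)).card < 2 * a)
    (hnum : 6 * p * n + 2 * (n.choose 2 - t.choose 2) ≤ t.choose 2)
    (r : ℕ) (hr : r ≤ 3 * m - t) :
    ∃ I U, Ach F I U ∧ I.card = r ∧ r ≤ (U.filter (fun x => t < x)).card := by
  induction r with
  | zero => exact ⟨∅, ∅, Ach.empty F, by simp, by simp⟩
  | succ r ih =>
    obtain ⟨I, U, hA, hI, hU⟩ := ih (by omega)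
    have hUc := hA.card hK
    -- an unused index
    have : ∃ i, i ∉ I ∧ ({p, 2 * p, t + 1} : Finset ℕ) ∉ F i := by
      by_contra hcon
      push Not at hcon
      have hsub : (Finset.univ : Finset (Fin m)) ⊆
          I ∪ Finset.univ.filter (fun i => ({p, 2 * p, t + 1} : Finset ℕ) ∈ F i) := by
        intro i _
        by_cases hi : i ∈ I
        · exact Finset.mem_union_left _ hi
        · exact Finset.mem_union_right _ (by simp [hcon i hi])
      have := (Finset.card_le_card hsub).trans (Finset.card_union_le _ _)
      simp only [Finset.card_univ, Fintype.card_fin] at this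
      omega
    obtain ⟨i, hiI, hmiss⟩ := this
    have : ∃ f ∈ F i, ¬ f ⊆ Finset.Icc 1 t ∧ Disjoint f U := by
      by_contra hcon
      push Not at hcon
      set U1 := U.filter (fun x => t < x) with hU1
      set U2 := U.filter (fun x => ¬ t < x) with hU2
      have hsum : U1.card + U2.card = U.card := Finset.card_filter_add_card_filter_not _
      have hsub : F i ⊆ (Finset.Icc 1 t).powersetCard 3 ∪
          (U1.biUnion (fun x => (F i).filter (fun e => x ∈ e)) ∪
           U2.biUnion (fun x => (F i).filter (fun e => x ∈ e ∧ ¬ e ⊆ Finset.Icc 1 t))) := by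
        intro e he
        by_cases h : e ⊆ Finset.Icc 1 t
        · exact Finset.mem_union_left _ (Finset.mem_powersetCard.mpr ⟨h, (hK i e he).2⟩)
        · apply Finset.mem_union_right
          obtain ⟨x, hx, hxU⟩ := Finset.not_disjoint_iff.mp (hcon e he h)
          by_cases hxt : t < x
          · apply Finset.mem_union_left
            exact Finset.mem_biUnion.mpr ⟨x, by simp [hU1, hxU, hxt], by simp [he, hx]⟩
          · apply Finset.mem_union_right
            refine Finset.mem_biUnion.mpr ⟨x, by simp [hU2, hxU]; omega, ?_⟩
            exact Finset.mem_filter.mpr ⟨he, hx, h⟩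
      have hb1 : (U1.biUnion (fun x => (F i).filter (fun e => x ∈ e))).card
          ≤ U1.card * (2 * p * n) := by
        apply Finset.card_biUnion_le_card_mul
        intro x hx
        refine deg_small (hK i) (hS i) hp (by omega) (by omega) hmiss ?_
        have := (Finset.mem_filter.mp hx).2
        omega
      have hb2 : (U2.biUnion (fun x => (F i).filter (fun e => x ∈ e ∧ ¬ e ⊆ Finset.Icc 1 t))).card
          ≤ U2.card * (n.choose 2 - t.choose 2) := by
        apply Finset.card_biUnion_le_card_mul
        intro x hx
        refine deg_leave (hK i) (by omega) ?_
        have := (Finset.mem_filter.mp hx).2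
        omega
      have htot := (Finset.card_le_card hsub).trans ((Finset.card_union_le _ _).trans
        (Nat.add_le_add_left (Finset.card_union_le _ _) _))
      rw [Finset.card_powersetCard, Nat.card_Icc, Nat.add_sub_cancel] at htot
      have hc := hcard i
      have hg := choose_gap t (3 * m - 1 - t)
      rw [show t + (3 * m - 1 - t) = 3 * m - 1 by omega] at hg
      have e1 : U1.card * (2 * p * n) ≤ (3 * r) * (2 * p * n) :=
        Nat.mul_le_mul_right _ (by omega)
      have e2 : U2.card * (n.choose 2 - t.choose 2) ≤ (2 * r) * (n.choose 2 - t.choose 2) :=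
        Nat.mul_le_mul_right _ (by omega)
      have e3 : r * t.choose 2 ≤ (3 * m - 1 - t) * t.choose 2 :=
        Nat.mul_le_mul_right _ (by omega)
      have e4 := Nat.mul_le_mul_left r hnum
      have e5 : r * (6 * p * n + 2 * (n.choose 2 - t.choose 2)) =
        (3 * r) * (2 * p * n) + (2 * r) * (n.choose 2 - t.choose 2) := by ring
      omega
    obtain ⟨f, hf, hft, hfU⟩ := this
    refine ⟨_, _, hA.extend hiI hf hfU, ?_, ?_⟩
    · rw [Finset.card_insert_of_notMem hiI, hI]
    · rw [Finset.filter_union, Finset.card_union_of_disjoint]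
      · have : 1 ≤ (f.filter (fun x => t < x)).card := by
          obtain ⟨w, hw, hw2⟩ := Finset.not_subset.mp hft
          have hw1 := Finset.mem_Icc.mp ((hK i f hf).1 hw)
          apply Finset.card_pos.mpr
          refine ⟨w, Finset.mem_filter.mpr ⟨hw, ?_⟩⟩
          simp at hw2; omega
        omega
      · exact Finset.disjoint_filter_filter hfU

/-- Second stage: cover the bad indices. -/
lemma bad_stage {n m p : ℕ} {F : Fin m → Finset (Finset ℕ)}
    (hK : ∀ i, IsKGraphOn n 3 (F i)) (hS : ∀ i, StableGraph n (F i))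
    (hpn : 3 * p ≤ n) (hbig : ∀ i, ({p, 2 * p, 3 * p} : Finset ℕ) ∈ F i)
    {I : Finset (Fin m)} {U : Finset ℕ} (h : Ach F I U) (B : Finset (Fin m))
    (hp : 3 * (I.card + B.card) < p) :
    ∃ I' U', Ach F I' U' ∧ B ⊆ I' ∧ U ⊆ U' ∧ I'.card ≤ I.card + B.card := by
  induction B using Finset.induction_on with
  | empty => exact ⟨I, U, h, by simp, by simp, by simp⟩
  | insert i B hiB ih =>
    rw [Finset.card_insert_of_notMem hiB] at hp ⊢
    obtain ⟨I', U', hA, hB, hU, hc⟩ := ih (by omega)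
    by_cases hi : i ∈ I'
    · exact ⟨I', U', hA, Finset.insert_subset hi hB, hU, by omega⟩
    · have hUc := hA.card hK
      have : ∃ v ∈ Finset.Icc (2 * p + 1) (3 * p), v ∉ U' := by
        by_contra hcon
        push Not at hcon
        have := Finset.card_le_card (show Finset.Icc (2 * p + 1) (3 * p) ⊆ U' from hcon)
        simp at this
        omega
      obtain ⟨v, hv, hvU⟩ := this
      rw [Finset.mem_Icc] at hv
      obtain ⟨U'', hA', hU'⟩ := hA.greedy (p := p) (v := v) hK hS hi (by omega) (by omega) hvU
        (stable_three (hS i) (by omega) (by omega) (by omega) (by omega) (by omega) (by omega)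
          le_rfl le_rfl hv.2 (hbig i)) (by omega)
      refine ⟨_, U'', hA', Finset.insert_subset_insert _ hB, ?_, ?_⟩
      · exact hU.trans ((Finset.subset_insert _ _).trans hU')
      · rw [Finset.card_insert_of_notMem hi]; omega

/-- Third stage: cover `(q, q+k]`. -/
lemma cover_stage {n m p a t q : ℕ} {F : Fin m → Finset (Finset ℕ)}
    (hK : ∀ i, IsKGraphOn n 3 (F i)) (hS : ∀ i, StableGraph n (F i))
    (hp1 : 1 ≤ p) (hpq : 2 * p ≤ q) (htn : t ≤ n)
    (hmany : 2 * a ≤ (Finset.univ.filter (fun i => ({p, 2 * p, t} : Finset ℕ) ∈ F i)).card)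
    {I : Finset (Fin m)} {U : Finset ℕ} (h : Ach F I U) (k : ℕ) (hk : q + k ≤ t)
    (hIa : I.card + k ≤ 2 * a) (hp : 6 * a < p) :
    ∃ I' U', Ach F I' U' ∧ I ⊆ I' ∧ U ⊆ U' ∧ I'.card ≤ I.card + k ∧
      Finset.Icc (q + 1) (q + k) ⊆ U' := by
  induction k with
  | zero => exact ⟨I, U, h, by simp, by simp, by simp, by simp⟩
  | succ k ih =>
    obtain ⟨I', U', hA, hI, hU, hc, hcov⟩ := ih (by omega) (by omega)
    have hcov' : ∀ W, U' ⊆ W → q + k + 1 ∈ W → Finset.Icc (q + 1) (q + (k + 1)) ⊆ W := by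
      intro W hW hq x hx
      rw [Finset.mem_Icc] at hx
      by_cases hxk : x = q + k + 1
      · rw [hxk]; exact hq
      · exact hW (hcov (Finset.mem_Icc.mpr ⟨hx.1, by omega⟩))
    by_cases hq : q + k + 1 ∈ U'
    · exact ⟨I', U', hA, hI, hU, by omega, hcov' U' (Finset.Subset.refl _) hq⟩
    · have : ∃ i, ({p, 2 * p, t} : Finset ℕ) ∈ F i ∧ i ∉ I' := by
        by_contra hcon
        push Not at hcon
        have := Finset.card_le_card
          (show Finset.univ.filter (fun i => ({p, 2 * p, t} : Finset ℕ) ∈ F i) ⊆ I' from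
            fun i hi => hcon i (Finset.mem_filter.mp hi).2)
        omega
      obtain ⟨i, hiF, hi⟩ := this
      obtain ⟨U'', hA', hU'⟩ := hA.greedy (p := p) (v := q + k + 1) hK hS hi (by omega) (by omega)
        hq (stable_three (hS i) (by omega) (by omega) (by omega) (by omega) (by omega) (by omega)
          le_rfl le_rfl (by omega) hiF) (by omega)
      have hU'2 : U' ⊆ U'' := (Finset.subset_insert _ _).trans hU'
      refine ⟨_, U'', hA', hI.trans (Finset.subset_insert _ _), hU.trans hU'2, ?_,
        hcov' U'' hU'2 (hU' (by simp))⟩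
      rw [Finset.card_insert_of_notMem hi]; omega

/-- Assembly, given the threshold `t` and the first stage. -/
lemma assemble {n m p a t : ℕ} {F : Fin m → Finset (Finset ℕ)}
    (hK : ∀ i, IsKGraphOn n 3 (F i)) (hS : ∀ i, StableGraph n (F i))
    (hp : 6 * a < p) (hpm : 3 * p + a ≤ 3 * m) (hmn : 3 * m ≤ n)
    (hbig : ∀ i, ({p, 2 * p, 3 * p} : Finset ℕ) ∈ F i)
    (B : Finset (Fin m)) (hB : B.card ≤ a)
    (hgood : ∀ i, i ∉ B → (Finset.Icc 1 (3 * m - a)).powersetCard 3 ⊆ F i)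
    (hta : 3 * m ≤ t + a) (htm : t ≤ 3 * m)
    (hmany : 2 * a ≤ (Finset.univ.filter (fun i => ({p, 2 * p, t} : Finset ℕ) ∈ F i)).card)
    {I : Finset (Fin m)} {U : Finset ℕ} (h : Ach F I U) (hI : I.card = 3 * m - t)
    (hU : 3 * m - t ≤ (U.filter (fun x => t < x)).card) : HasRainbowMatching F := by
  obtain ⟨I1, U1, hA1, hB1, hU1, hc1⟩ := bad_stage hK hS (by omega) hbig h B (by omega)
  obtain ⟨I2, U2, hA2, hI2, hU2, hc2, hcov⟩ := cover_stage (q := 3 * m - a) hK hS (by omega)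
    (by omega) (by omega) hmany hA1 (t + a - 3 * m) (by omega) (by omega) hp
  rw [show 3 * m - a + (t + a - 3 * m) = t by omega] at hcov
  have hUc := hA2.card hK
  have hle : I2.card ≤ m := by simpa using I2.card_le_univ
  refine hA2.finish (q := 3 * m - a) (m - I2.card) I2 U2 rfl ?_ ?_
  · intro i hi
    exact hgood i (fun hiB => hi (hI2 (hB1 hiB)))
  · have hout : a ≤ (U2 \ Finset.Icc 1 (3 * m - a)).card := by
      have hsub : Finset.Icc (3 * m - a + 1) t ∪ U.filter (fun x => t < x) ⊆
          U2 \ Finset.Icc 1 (3 * m - a) := by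
        intro x hx
        rw [Finset.mem_sdiff]
        rcases Finset.mem_union.mp hx with hx | hx
        · refine ⟨hcov hx, ?_⟩
          simp at hx ⊢; omega
        · refine ⟨hU2 (hU1 (Finset.mem_filter.mp hx).1), ?_⟩
          simp at hx ⊢; omega
      have := Finset.card_le_card hsub
      rw [Finset.card_union_of_disjoint] at this
      · simp only [Nat.card_Icc] at this
        omega
      · rw [Finset.disjoint_left]
        intro x hx hx2
        simp at hx hx2; omega
    have e1 := Finset.card_sdiff_add_card_inter (Finset.Icc 1 (3 * m - a)) U2
    have e2 := Finset.card_sdiff_add_card_inter U2 (Finset.Icc 1 (3 * m - a))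
    rw [Finset.inter_comm] at e2
    simp only [Nat.card_Icc] at e1
    omega

lemma choose_three_real (k : ℕ) : (k.choose 3 : ℝ) = k * (k - 1) * (k - 2) / 6 := by
  induction k with
  | zero => simp
  | succ k ih =>
    have h1 : (k + 1).choose 3 = k.choose 2 + k.choose 3 := Nat.choose_succ_succ _ _
    rw [h1, Nat.cast_add, ih, Nat.cast_choose_two]
    push_cast
    ring

lemma num_bad {n m a : ℕ} (ha : 1000 ≤ a) (han : 1000000 * a ≤ n) (h27 : n ≤ 27 * m) :
    (3 * (10 * a) - 1).choose 3 + 2 * (10 * a) * n.choose 2 ≤ (3 * m - 1).choose 3 := by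
  have hm : 1000 ≤ m := by omega
  have hR : ((3 * (10 * a) - 1).choose 3 + 2 * (10 * a) * n.choose 2 : ℝ)
      ≤ (3 * m - 1).choose 3 := by
    rw [choose_three_real, choose_three_real, Nat.cast_choose_two,
      Nat.cast_sub (by omega), Nat.cast_sub (by omega)]
    push_cast
    have haR : (1000 : ℝ) ≤ a := by exact_mod_cast ha
    have hanR : (1000000 * a : ℝ) ≤ n := by exact_mod_cast han
    have h27R : (n : ℝ) ≤ 27 * m := by exact_mod_cast h27
    have hmR : (1000 : ℝ) ≤ m := by exact_mod_cast hm
    generalize (a : ℝ) = a at *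
    generalize (n : ℝ) = n at *
    generalize (m : ℝ) = m at *
    have ham : a ≤ 27 * m / 1000000 := by linarith
    -- crude bounds
    have b1 : (30 * a - 1) * (30 * a - 2) * (30 * a - 3) ≤ (m / 1000) ^ 3 := by
      have h1 : 30 * a - 1 ≤ m / 1000 := by linarith
      have h2 : 30 * a - 2 ≤ m / 1000 := by linarith
      have h3 : 30 * a - 3 ≤ m / 1000 := by linarith
      have h0 : 0 ≤ m / 1000 := by linarith
      calc (30 * a - 1) * (30 * a - 2) * (30 * a - 3)
          ≤ (m / 1000) * (m / 1000) * (m / 1000) := by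
            apply mul_le_mul (mul_le_mul h1 h2 (by linarith) h0) h3 (by linarith) (by positivity)
        _ = _ := by ring
    have b2 : a * (n * (n - 1)) ≤ (27 * m / 1000000) * ((27 * m) * (27 * m)) := by
      apply mul_le_mul ham _ _ (by linarith)
      · apply mul_le_mul h27R (by linarith) (by linarith) (by linarith)
      · apply mul_nonneg <;> linarith
    have b3 : 20 * m ^ 3 ≤ (3 * m - 1) * (3 * m - 2) * (3 * m - 3) := by
      nlinarith [mul_nonneg (sub_nonneg.mpr hmR) (sq_nonneg m), sq_nonneg m]
    have hm3 : 0 ≤ m ^ 3 := by positivity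
    nlinarith
  have h1 : 1 ≤ 3 * (10 * a) := by omega
  exact_mod_cast hR

lemma num_case1 {n m a : ℕ} (ha : 1000 ≤ a) (han : 1000000 * a ≤ n) (h27 : n ≤ 27 * m)
    (hmn : 3 * m ≤ n) (h18 : 18 * m ≤ 5 * n) :
    (3 * m - 1).choose 3 + 2 * (10 * a) * n.choose 2 ≤
      n.choose 3 - (n - m + 1).choose 3 := by
  have hm : 1000 ≤ m := by omega
  have hR : ((3 * m - 1).choose 3 + 2 * (10 * a) * n.choose 2 + (n - m + 1).choose 3 : ℝ)
      ≤ n.choose 3 := by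
    rw [choose_three_real, choose_three_real, choose_three_real, Nat.cast_choose_two,
      Nat.cast_sub (by omega), Nat.cast_add, Nat.cast_sub (by omega)]
    push_cast
    have haR : (1000 : ℝ) ≤ a := by exact_mod_cast ha
    have hanR : (1000000 * a : ℝ) ≤ n := by exact_mod_cast han
    have h27R : (n : ℝ) ≤ 27 * m := by exact_mod_cast h27
    have hmnR : (3 * m : ℝ) ≤ n := by exact_mod_cast hmn
    have h18R : (18 * m : ℝ) ≤ 5 * n := by exact_mod_cast h18
    have hmR : (1000 : ℝ) ≤ m := by exact_mod_cast hm
    generalize (a : ℝ) = a at *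
    generalize (n : ℝ) = n at *
    generalize (m : ℝ) = m at *
    have ham : a ≤ 27 * m / 1000000 := by linarith
    have b2 : a * (n * (n - 1)) ≤ (27 * m / 1000000) * (n * n) := by
      apply mul_le_mul ham _ _ (by linarith)
      · nlinarith
      · apply mul_nonneg <;> linarith
    have b3 : (1 / 10) * (n * n) ≤ 3 * n ^ 2 - 3 * n * m - 26 * m ^ 2 := by
      nlinarith [mul_nonneg (sub_nonneg.mpr h18R) (show 0 ≤ n by linarith),
        mul_nonneg (sub_nonneg.mpr h18R) (show 0 ≤ m by linarith)]
    have b4 : m * ((1 / 10) * (n * n)) ≤ m * (3 * n ^ 2 - 3 * n * m - 26 * m ^ 2) :=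
      mul_le_mul_of_nonneg_left b3 (by linarith)
    have b5 : 1000 * (n * n) ≤ m * (n * n) :=
      mul_le_mul_of_nonneg_right hmR (by nlinarith)
    have b6 : 0 ≤ m * m := by nlinarith
    nlinarith
  have : (3 * m - 1).choose 3 + 2 * (10 * a) * n.choose 2 + (n - m + 1).choose 3
      ≤ n.choose 3 := by
    exact_mod_cast hR
  omega

lemma num_case2 {n m a t : ℕ} (ha : 1000 ≤ a) (han : 1000000 * a ≤ n)
    (hmn : 3 * m ≤ n) (h18 : 5 * n ≤ 18 * m) (hta : 3 * m ≤ t + a) (htm : t ≤ 3 * m) :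
    6 * (10 * a) * n + 2 * (n.choose 2 - t.choose 2) ≤ t.choose 2 := by
  have hm : 1000 ≤ m := by omega
  have hR : (6 * (10 * a) * n + 2 * n.choose 2 : ℝ) ≤ 3 * t.choose 2 := by
    rw [Nat.cast_choose_two, Nat.cast_choose_two]
    have haR : (1000 : ℝ) ≤ a := by exact_mod_cast ha
    have hanR : (1000000 * a : ℝ) ≤ n := by exact_mod_cast han
    have hmnR : (3 * m : ℝ) ≤ n := by exact_mod_cast hmn
    have h18R : (5 * n : ℝ) ≤ 18 * m := by exact_mod_cast h18
    have htaR : (3 * m : ℝ) ≤ t + a := by exact_mod_cast hta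
    have hmR : (1000 : ℝ) ≤ m := by exact_mod_cast hm
    generalize (a : ℝ) = a at *
    generalize (n : ℝ) = n at *
    generalize (m : ℝ) = m at *
    generalize (t : ℝ) = t at *
    have ham : a ≤ m / 100000 := by linarith
    have ht : 2.99 * m ≤ t := by linarith
    have ht1 : 2.98 * m ≤ t - 1 := by linarith
    have b1 : (2.99 * m) * (2.98 * m) ≤ t * (t - 1) :=
      mul_le_mul ht ht1 (by linarith) (by linarith)
    have b2 : n * (n - 1) ≤ (3.6 * m) * (3.6 * m) :=
      mul_le_mul (by linarith) (by linarith) (by linarith) (by linarith)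
    have b3 : a * n ≤ (m / 100000) * (3.6 * m) :=
      mul_le_mul ham (by linarith) (by linarith) (by linarith)
    have b4 : 0 ≤ m * m := by nlinarith
    nlinarith
  have : 6 * (10 * a) * n + 2 * n.choose 2 ≤ 3 * t.choose 2 := by exact_mod_cast hR
  have h2 : t.choose 2 ≤ n.choose 2 := Nat.choose_le_choose 2 (by omega)
  omega

lemma num_eps {n m a b : ℕ} {ε : ℝ} (hε : 0 < ε) (hε1 : ε < 1 / 10 ^ 27) (ha : 1000 ≤ a)
    (hna : n < 1000000 * (a + 1)) (hmn : 3 * m ≤ n)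
    (h : ((b * a.choose 3 : ℕ) : ℝ) ≤ ε * ((n + m : ℕ) : ℝ) ^ 4) : b ≤ a := by
  by_contra hcon
  push Not at hcon
  have hb : ((a + 1) * a.choose 3 : ℝ) ≤ ((b * a.choose 3 : ℕ) : ℝ) := by
    exact_mod_cast Nat.mul_le_mul_right _ hcon
  have hN : ((n + m : ℕ) : ℝ) ≤ 2000000 * (a + 1) := by
    have : n + m ≤ 2000000 * (a + 1) := by omega
    exact_mod_cast this
  have haR : (1000 : ℝ) ≤ a := by exact_mod_cast ha
  have h4 : ((n + m : ℕ) : ℝ) ^ 4 ≤ (2000000 * ((a : ℝ) + 1)) ^ 4 := by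
    gcongr
  have h5 : ε * ((n + m : ℕ) : ℝ) ^ 4 ≤ (1 / 10 ^ 27) * (2000000 * ((a : ℝ) + 1)) ^ 4 := by
    apply mul_le_mul hε1.le h4 (by positivity) (by positivity)
  rw [choose_three_real] at hb
  have h6 := hb.trans (h.trans h5)
  generalize (a : ℝ) = a at *
  have h7 : (1 / 10 ^ 27) * (2000000 * (a + 1)) ^ 4 = (a + 1) * ((16 / 1000) * (a + 1) ^ 3) := by
    ring
  rw [h7] at h6
  have h8 := le_of_mul_le_mul_left h6 (by linarith)
  nlinarith [mul_nonneg (sub_nonneg.mpr haR) (sq_nonneg a), sq_nonneg a]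

/-- if `H(F)` is `ε`-close to `H_D(n,m,3)` then the stable family
`F` admits a rainbow matching. -/
theorem close_to_HD_implies_rainbow :
    ∃ c₀ : ℝ, 0 < c₀ ∧ ∀ c : ℝ, 0 < c → c < c₀ →
      ∃ ε₀ : ℝ, 0 < ε₀ ∧ ∀ ε : ℝ, 0 < ε → ε < ε₀ →
        ∃ n₀ : ℕ, ∀ n : ℕ, n ≥ n₀ → ∀ m : ℕ, 0 < m →
          (n : ℝ) / 27 ≤ (m : ℝ) → (m : ℝ) ≤ (1 - c) * n / 3 →
          ∀ F : Fin m → Finset (Finset ℕ), (∀ i, IsKGraphOn n 3 (F i)) →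
            (∀ i, StableGraph n (F i)) → (∀ i, (F i).card > fEMC n m 3) →
            IsEpsClose ε (n + m) 4 (HD n m 3) (HF n F) →
            HasRainbowMatching F := by
  refine ⟨1, one_pos, fun c hc _ => ⟨1 / 10 ^ 27, by positivity, fun ε hε hε1 =>
    ⟨10 ^ 10, fun n hn m hm0 h27R h3R F hK hS hcard hclose => ?_⟩⟩⟩
  have h27 : n ≤ 27 * m := by
    have : (n : ℝ) ≤ 27 * m := by linarith
    exact_mod_cast this
  have hmn : 3 * m ≤ n := by
    have hn0 : (0 : ℝ) ≤ n := Nat.cast_nonneg n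
    have : (3 * m : ℝ) ≤ n := by nlinarith
    exact_mod_cast this
  obtain ⟨a, hadef⟩ : ∃ a, a = n / 1000000 := ⟨_, rfl⟩
  have han : 1000000 * a ≤ n := by omega
  have hna : n < 1000000 * (a + 1) := by omega
  have ha : 1000 ≤ a := by omega
  have hcD : ∀ i, (3 * m - 1).choose 3 < (F i).card := fun i =>
    lt_of_le_of_lt (le_max_right _ _) (hcard i)
  have hcS : ∀ i, n.choose 3 - (n - m + 1).choose 3 < (F i).card := fun i =>
    lt_of_le_of_lt (le_max_left _ _) (hcard i)
  -- bad indices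
  set B : Finset (Fin m) := Finset.univ.filter
    (fun i => a.choose 3 ≤ (DGraph n m 3 \ F i).card) with hBdef
  have hB : B.card ≤ a := by
    have h1 := bad_count (C := a.choose 3) hK hmn B (fun i hi => (Finset.mem_filter.mp hi).2)
    have h2 : ((B.card * a.choose 3 : ℕ) : ℝ) ≤ ε * ((n + m : ℕ) : ℝ) ^ 4 :=
      le_trans (by exact_mod_cast h1) hclose
    exact num_eps hε hε1 ha hna hmn h2
  have hgood : ∀ i, i ∉ B → (Finset.Icc 1 (3 * m - a)).powersetCard 3 ⊆ F i := by
    intro i hi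
    refine good_of_few (hS i) (by omega) (by omega) hmn ?_
    by_contra hcon
    exact hi (by simp [hBdef]; omega)
  have hbig : ∀ i, ({10 * a, 2 * (10 * a), 3 * (10 * a)} : Finset ℕ) ∈ F i := by
    intro i
    by_contra hmiss
    have h1 := card_le_of_missing (hK i) (hS i) (by omega) (by omega) (by omega) hmiss
    have h2 := num_bad ha han h27
    have h3 := hcD i
    omega
  -- the threshold
  let P : ℕ → Prop := fun t => 2 * a ≤ (Finset.univ.filter
    (fun i => ({10 * a, 2 * (10 * a), t} : Finset ℕ) ∈ F i)).card
  have hP0 : P (3 * m - a) := by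
    have hsub : Bᶜ ⊆ Finset.univ.filter
        (fun i => ({10 * a, 2 * (10 * a), 3 * m - a} : Finset ℕ) ∈ F i) := by
      intro i hi
      refine Finset.mem_filter.mpr ⟨by simp, hgood i (by simpa using hi) ?_⟩
      rw [Finset.mem_powersetCard]
      constructor
      · intro x hx
        simp at hx ⊢
        omega
      · rw [Finset.card_eq_three]
        exact ⟨_, _, _, by omega, by omega, by omega, rfl⟩
    have := Finset.card_le_card hsub
    rw [Finset.card_compl, Fintype.card_fin] at this
    show 2 * a ≤ _
    omega
  have hex : ∃ t, 3 * m ≤ t + a ∧ t ≤ 3 * m ∧ P t ∧ (t < 3 * m → ¬ P (t + 1)) := by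
    classical
    refine ⟨Nat.findGreatest P (3 * m), ?_, Nat.findGreatest_le _, ?_, ?_⟩
    · have := Nat.le_findGreatest (P := P) (show 3 * m - a ≤ 3 * m by omega) hP0
      omega
    · exact Nat.findGreatest_spec (P := P) (show 3 * m - a ≤ 3 * m by omega) hP0
    · intro hlt
      exact Nat.findGreatest_is_greatest (P := P) (Nat.lt_succ_self _) hlt
  obtain ⟨t, hta, htm, hPt, hPt1⟩ := hex
  have hstage : ∃ I U, Ach F I U ∧ I.card = 3 * m - t ∧
      3 * m - t ≤ (U.filter (fun x => t < x)).card := by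
    rcases Nat.lt_or_ge t (3 * m) with hlt | hge
    · have hfew := hPt1 hlt
      simp only [P, not_le] at hfew
      have h18 : 5 * n ≤ 18 * m := by
        by_contra hcon
        have hall : ∀ i, ({10 * a, 2 * (10 * a), t + 1} : Finset ℕ) ∈ F i := by
          intro i
          have h3m : ({10 * a, 2 * (10 * a), 3 * m} : Finset ℕ) ∈ F i := by
            by_contra hmiss
            have h1 := card_le_of_missing (hK i) (hS i) (by omega) (by omega) (by omega) hmiss
            have h2 := num_case1 ha han h27 hmn (by omega)
            have h3 := hcS i
            omega
          exact stable_three (hS i) (by omega) (by omega) (by omega) (by omega) (by omega)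
            (by omega) le_rfl le_rfl (by omega) h3m
        rw [Finset.filter_true_of_mem (fun i _ => hall i)] at hfew
        simp only [Finset.card_univ, Fintype.card_fin] at hfew
        omega
      exact first_stage hK hS (by omega) (by omega) hlt hta hmn (by omega) hcD hfew
        (num_case2 ha han hmn h18 hta htm) _ le_rfl
    · exact ⟨∅, ∅, Ach.empty F, by simp; omega, by simp; omega⟩
  obtain ⟨I, U, hA, hI, hU⟩ := hstage
  exact assemble hK hS (by omega) (by omega) hmn hbig B hB hgood hta htm hPt hA hI hU
end
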